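/- arXiv:2212.07122 — 2 statements merged into one kernel-verified Lean document; each statement's English description precedes it below -/
import Mathlib

section
/- Let R be a commutative Noetherian ring, 𝔞 an ideal of R, and L a finitely generated R-module. Then the union over all i ≥ 0 of the supports Supp_R(H^i_𝔞(L)) of the local cohomology modules equals Supp_R(L/𝔞L). -/
open CategoryTheory Opposite
open scoped TensorProduct

universe u

variable (R : Type u) [CommRing R]

/-- The Ext module `Ext^i_R(R/a, M)` as an object of `ModuleCat R`. -/
noncomputable def relExt (a : Ideal R) (i : ℕ)
    (M : Type u) [AddCommGroup M] [Module R M] : ModuleCat R :=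
  ((Ext R (ModuleCat R) i).obj (op (ModuleCat.of R (R ⧸ a)))).obj (ModuleCat.of R M)

/-- `grade(a, M) = inf { i | Ext^i_R(R/a, M) ≠ 0 }`. -/
noncomputable def rgrade (a : Ideal R) (M : Type u) [AddCommGroup M] [Module R M] : ℕ :=
  sInf {i | Nontrivial (relExt R a i M)}

/-- The local cohomology module `H^i_a(M)` as an object of `ModuleCat R`. -/
noncomputable def localCoh (a : Ideal R) (i : ℕ)
    (M : Type u) [AddCommGroup M] [Module R M] : ModuleCat R :=
  (localCohomology a i).obj (ModuleCat.of R M)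

/-- `cd(a, M) = sup { i | H^i_a(M) ≠ 0 }` (cohomological dimension). -/
noncomputable def rcd (a : Ideal R) (M : Type u) [AddCommGroup M] [Module R M] : ℕ :=
  sSup {i | Nontrivial (localCoh R a i M)}

/-- `M` is `a`-relative Cohen-Macaulay: `M = aM`, or `M ≠ aM` and
`grade(a,M) = cd(a,M)`. -/
def IsRelCM (a : Ideal R) (M : Type u) [AddCommGroup M] [Module R M] : Prop :=
  (a • (⊤ : Submodule R M) = ⊤) ∨
    (a • (⊤ : Submodule R M) ≠ ⊤ ∧ rgrade R a M = rcd R a M)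

/-- `ara(a, M)`: the arithmetic rank of `a` with respect to `M`. -/
noncomputable def ara (a : Ideal R) (M : Type u) [AddCommGroup M] [Module R M] : ℕ :=
  sInf {n | ∃ x : Fin n → R,
    (Ideal.span (Set.range x) + Module.annihilator R M).radical
      = (a + Module.annihilator R M).radical}

/-- Projective dimension of `M`, characterized by Ext-vanishing, valued in `ℕ∞`. -/
noncomputable def rpd (M : Type u) [AddCommGroup M] [Module R M] : ℕ∞ :=
  sSup ((fun i : ℕ => (i : ℕ∞)) '' {i : ℕ | ∃ N : ModuleCat R,
    Nontrivial (((Ext R (ModuleCat R) i).obj (op (ModuleCat.of R M))).obj N)})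

/-- Injective dimension of `M`, characterized by Ext-vanishing, valued in `ℕ∞`. -/
noncomputable def rid (M : Type u) [AddCommGroup M] [Module R M] : ℕ∞ :=
  sSup ((fun i : ℕ => (i : ℕ∞)) '' {i : ℕ | ∃ N : ModuleCat R,
    Nontrivial (((Ext R (ModuleCat R) i).obj (op N)).obj (ModuleCat.of R M))})

/-- The `a`-relative injective dimension `a-id_R M = sup{i | Ext^i(R/a, M) ≠ 0}`,
valued in `ℕ∞`. -/
noncomputable def raid (a : Ideal R) (M : Type u) [AddCommGroup M] [Module R M] : ℕ∞ :=
  sSup ((fun i : ℕ => (i : ℕ∞)) '' {i : ℕ | Nontrivial (relExt R a i M)})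

/-- `μ(a)`: the minimal number of generators of the ideal `a`. -/
noncomputable def mu (a : Ideal R) : ℕ :=
  sInf {n | ∃ s : Finset R, s.card = n ∧ Ideal.span (↑s : Set R) = a}

/-- `R` is `a`-relative regular: `a` is generated by an `R`-regular sequence of
length `cd(a,R)`. -/
def IsRelRegularRing (a : Ideal R) : Prop :=
  ∃ rs : List R, RingTheory.Sequence.IsRegular R rs ∧ rs.length = rcd R a R ∧
    Ideal.ofList rs = a

/-- `M` is an `a`-relative regular module: `M = aM`, or `M ≠ aM` and `a` is generated by
a sequence of length `cd(a,R)` that is both an `M`-regular and an `R`-regular sequence. -/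
def IsRelRegularMod (a : Ideal R) (M : Type u) [AddCommGroup M] [Module R M] : Prop :=
  (a • (⊤ : Submodule R M) = ⊤) ∨
    (a • (⊤ : Submodule R M) ≠ ⊤ ∧ ∃ rs : List R, rs.length = rcd R a R ∧
      Ideal.ofList rs = a ∧ RingTheory.Sequence.IsRegular M rs ∧
      RingTheory.Sequence.IsRegular R rs)

open Limits

namespace LC
variable {R}
variable {X X' : ModuleCat.{u} R} (P : ProjectiveResolution X) (P' : ProjectiveResolution X')

noncomputable def yMap (φ : P.complex ⟶ P'.complex) (Y : ModuleCat.{u} R) :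
    P'.complex.linearYonedaObj R Y ⟶ P.complex.linearYonedaObj R Y :=
  (HomologicalComplex.unopFunctor _ _).map
    ((((linearYoneda R (ModuleCat R)).obj Y).rightOp.mapHomologicalComplex _).map φ).op

lemma yMap_f (φ : P.complex ⟶ P'.complex) (Y : ModuleCat.{u} R) (i : ℕ) (f : P'.complex.X i ⟶ Y) :
    ((yMap P P' φ Y).f i).hom f = φ.f i ≫ f := rfl

lemma iso_aux {C : Type*} [Category C] {A A' B B' : C} (a : A ≅ A') (b : B ≅ B')
    (f : A' ⟶ B') (g : A ⟶ B) (h : a.hom ≫ f = g ≫ b.hom) : f ≫ b.inv = a.inv ≫ g := by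
  rw [Iso.eq_inv_comp, ← Category.assoc, h, Category.assoc, b.hom_inv_id, Category.comp_id]

lemma ext_nat (g : X ⟶ X') (φ : P.complex ⟶ P'.complex) (comm : φ.f 0 ≫ P'.π.f 0 = P.π.f 0 ≫ g)
    (Y : ModuleCat.{u} R) (i : ℕ) :
    (((Ext R (ModuleCat R) i).map g.op).app Y) ≫ (P.isoExt i Y).hom =
    (P'.isoExt (R := R) i Y).hom ≫ HomologicalComplex.homologyMap (yMap P P' φ Y) i := by
  have h := ProjectiveResolution.isoLeftDerivedObj_inv_naturality g P P' φ comm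
    ((linearYoneda R (ModuleCat R)).obj Y).rightOp i
  have h2 := congrArg Quiver.Hom.unop h
  have h3 := HomologicalComplex.homologyOp_hom_naturality (yMap P P' φ Y) i
  have h4 := congrArg Quiver.Hom.unop h3
  let A := ((P'.complex.linearYonedaObj R Y).homologyOp i).unop
  let B := ((P.complex.linearYonedaObj R Y).homologyOp i).unop
  have h5 : A.hom ≫ (HomologicalComplex.homologyMap
      ((HomologicalComplex.opFunctor _ _).map (yMap P P' φ Y).op) i).unop =
      HomologicalComplex.homologyMap (yMap P P' φ Y) i ≫ B.hom := h4
  have h7 : (HomologicalComplex.homologyMap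
      ((HomologicalComplex.opFunctor _ _).map (yMap P P' φ Y).op) i).unop ≫ B.inv =
      A.inv ≫ HomologicalComplex.homologyMap (yMap P P' φ Y) i := by
    exact iso_aux A B _ _ h5
  have e1 : (P.isoExt (R := R) i Y).hom = (P.isoLeftDerivedObj
    ((linearYoneda R (ModuleCat R)).obj Y).rightOp i).inv.unop ≫ B.inv := rfl
  have e2 : (P'.isoExt (R := R) i Y).hom = (P'.isoLeftDerivedObj
    ((linearYoneda R (ModuleCat R)).obj Y).rightOp i).inv.unop ≫ A.inv := rfl
  rw [e1, e2]
  refine Eq.trans (Category.assoc _ _ _).symm ?_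
  refine Eq.trans (congrArg (· ≫ B.inv) h2) ?_
  refine Eq.trans (Category.assoc _ _ _) ?_
  refine Eq.trans ?_ (Category.assoc _ _ _).symm
  exact congrArg (_ ≫ ·) h7

variable {Y : ModuleCat.{u} R} {i : ℕ}

/-- `f` is a cocycle representing `e`. -/
def Rep (f : P.complex.X i ⟶ Y) (e : ((Ext R (ModuleCat R) i).obj (op X)).obj Y) : Prop :=
  ∃ z : (P.complex.linearYonedaObj R Y).cycles i,
    ((P.complex.linearYonedaObj R Y).iCycles i).hom z = f ∧
    ((P.complex.linearYonedaObj R Y).homologyπ i).hom z = (P.isoExt i Y).hom.hom e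

variable {P P'}

lemma Rep.smul {f : P.complex.X i ⟶ Y} {e} (h : Rep P f e) (r : R) : Rep P (r • f) (r • e) := by
  obtain ⟨z, hz, hz'⟩ := h
  refine ⟨r • z, ?_, ?_⟩
  · rw [map_smul, hz]; rfl
  · rw [map_smul, map_smul, hz']

lemma Rep.exists (e : ((Ext R (ModuleCat R) i).obj (op X)).obj Y) :
    ∃ f : P.complex.X i ⟶ Y, Rep P f e := by
  obtain ⟨z, hz⟩ := (ModuleCat.epi_iff_surjective
    ((P.complex.linearYonedaObj R Y).homologyπ i)).1 inferInstance ((P.isoExt i Y).hom.hom e)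
  exact ⟨_, z, rfl, hz⟩

lemma Rep.of_cocycle {f : P.complex.X i ⟶ Y} (hf : P.complex.d (i+1) i ≫ f = 0) :
    ∃ e, Rep P f e := by
  let K := P.complex.linearYonedaObj R Y
  let z : K.cycles i := K.cyclesMk (i := i) f (i+1) (by simp) hf
  have hz : (K.iCycles i).hom z = f := K.i_cyclesMk (i := i) f (i+1) (by simp) hf
  refine ⟨(P.isoExt i Y).inv.hom ((K.homologyπ i).hom z), z, hz, ?_⟩
  exact (LinearMap.congr_fun (congrArg ModuleCat.Hom.hom (P.isoExt i Y).inv_hom_id) _).symm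

lemma Rep.eq_zero {e : ((Ext R (ModuleCat R) i).obj (op X)).obj Y}
    (h : Rep P (0 : P.complex.X i ⟶ Y) e) : e = 0 := by
  obtain ⟨z, hz, hz'⟩ := h
  have hinj := (ModuleCat.mono_iff_injective
    ((P.complex.linearYonedaObj R Y).iCycles i)).1 inferInstance
  have : z = 0 := hinj (hz.trans (map_zero _).symm)
  rw [this, map_zero] at hz'
  have hinj := (ModuleCat.mono_iff_injective (P.isoExt (R := R) i Y).hom).1 inferInstance
  exact hinj (hz'.symm.trans (map_zero _).symm)

lemma Rep.unique {f : P.complex.X i ⟶ Y} {e e' : ((Ext R (ModuleCat R) i).obj (op X)).obj Y}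
    (h : Rep P f e) (h' : Rep P f e') : e = e' := by
  obtain ⟨z, hz, hz'⟩ := h
  obtain ⟨w, hw, hw'⟩ := h'
  have hinj := (ModuleCat.mono_iff_injective
    ((P.complex.linearYonedaObj R Y).iCycles i)).1 inferInstance
  have : z = w := hinj (hz.trans hw.symm)
  subst this
  have hinj := (ModuleCat.mono_iff_injective (P.isoExt (R := R) i Y).hom).1 inferInstance
  exact hinj (hz'.symm.trans hw')

lemma Rep.coboundary {f : P.complex.X i ⟶ Y} (h : Rep P f 0) :
    ∃ (j : ℕ) (g : P.complex.X j ⟶ Y), P.complex.d i j ≫ g = f := by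
  obtain ⟨z, hz, hz'⟩ := h
  rw [map_zero] at hz'
  let K := P.complex.linearYonedaObj R Y
  have hex := (ShortComplex.exact_of_g_is_cokernel (ShortComplex.mk _ _ (K.sc i).toCycles_comp_homologyπ) (K.sc i).homologyIsCokernel)
  rw [ShortComplex.moduleCat_exact_iff] at hex
  obtain ⟨g, hg⟩ := hex z hz'
  refine ⟨_, g, ?_⟩
  rw [← hz, ← hg]
  exact (LinearMap.congr_fun (congrArg ModuleCat.Hom.hom (K.sc i).toCycles_i) g).symm

lemma Rep.nat {g : X ⟶ X'} {φ : P.complex ⟶ P'.complex}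
    (comm : φ.f 0 ≫ P'.π.f 0 = P.π.f 0 ≫ g) {f : P'.complex.X i ⟶ Y} {e} (h : Rep P' f e) :
    Rep P (φ.f i ≫ f) ((((Ext R (ModuleCat R) i).map g.op).app Y).hom e) := by
  obtain ⟨z, hz, hz'⟩ := h
  refine ⟨(HomologicalComplex.cyclesMap (yMap P P' φ Y) i).hom z, ?_, ?_⟩
  · rw [← hz]
    exact LinearMap.congr_fun (congrArg ModuleCat.Hom.hom
      (HomologicalComplex.cyclesMap_i (yMap P P' φ Y) i)) z
  · have h1 := LinearMap.congr_fun (congrArg ModuleCat.Hom.hom (ext_nat P P' g φ comm Y i)) e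
    have h2 := LinearMap.congr_fun (congrArg ModuleCat.Hom.hom
      (HomologicalComplex.homologyπ_naturality (yMap P P' φ Y) i)) z
    refine h2.symm.trans (Eq.trans ?_ h1.symm)
    exact congrArg (HomologicalComplex.homologyMap (yMap P P' φ Y) i).hom hz'

end LC

section
variable {R}
variable (a : Ideal R) (M : ModuleCat.{u} R) (i : ℕ)
noncomputable def LC.D (a : Ideal R) (M : ModuleCat.{u} R) (i : ℕ) : ℕᵒᵖᵒᵖ ⥤ ModuleCat.{u} R :=
  localCohomology.diagram (localCohomology.idealPowersDiagram a) i ⋙ (evaluation _ _).obj M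

noncomputable def LC.isColim : IsColimit (((evaluation _ _).obj M).mapCocone (colimit.cocone (localCohomology.diagram (localCohomology.idealPowersDiagram a) i))) :=
  isColimitOfPreserves ((evaluation _ _).obj M) (colimit.isColimit (localCohomology.diagram (localCohomology.idealPowersDiagram a) i))

noncomputable def LC.ι (n : ℕ) : ((Ext R (ModuleCat R) i).obj (op (ModuleCat.of R (R ⧸ a^n)))).obj M ⟶
   (localCohomology a i).obj M := (colimit.ι (localCohomology.diagram (localCohomology.idealPowersDiagram a) i) (op (op n))).app M

instance LC.pres : PreservesColimitsOfShape ℕᵒᵖᵒᵖ (forget (ModuleCat.{u} R)) := by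
  have : PreservesFilteredColimitsOfSize.{0, 0} (forget (ModuleCat.{u} R)) :=
    preservesFilteredColimitsOfSize_shrink.{0, u, 0, u} _
  infer_instance

lemma LC.ι_surj (x : (localCohomology a i).obj M) : ∃ n e, (LC.ι a M i n).hom e = x := by
  obtain ⟨n, e, he⟩ := Concrete.isColimit_exists_rep _ (LC.isColim a M i) x
  exact ⟨n.unop.unop, e, he⟩

noncomputable def LC.q {m n : ℕ} (h : n ≤ m) : ModuleCat.of R (R ⧸ a^m) ⟶ ModuleCat.of R (R ⧸ a^n) :=
  ModuleCat.ofHom <| Submodule.mapQ _ _ LinearMap.id (Ideal.pow_le_pow_right h)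

lemma LC.ι_zero {n : ℕ} (e) (h : (LC.ι a M i n).hom e = 0) : ∃ m, ∃ hm : n ≤ m, 
    (((Ext R (ModuleCat R) i).map (LC.q a hm).op).app M).hom e = 0 := by
  obtain ⟨k, f, g, hk⟩ := Concrete.isColimit_exists_of_rep_eq _ (LC.isColim a M i) (i := op (op n)) (j := op (op n)) e 0 (h.trans (map_zero (LC.ι a M i n).hom).symm)
  refine ⟨k.unop.unop, f.unop.unop.down.down, Eq.trans hk (map_zero _)⟩
end

namespace LC
variable {R}

noncomputable abbrev PP (a : Ideal R) (n : ℕ) :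
    ProjectiveResolution (ModuleCat.of R (R ⧸ a ^ n)) := projectiveResolution _

noncomputable def aug {X : ModuleCat.{u} R} (P : ProjectiveResolution X) : P.complex.X 0 ⟶ X :=
  P.π.f 0

instance aug_epi {X : ModuleCat.{u} R} (P : ProjectiveResolution X) : Epi (aug P) :=
  inferInstanceAs (Epi (P.π.f 0))

lemma d_aug {X : ModuleCat.{u} R} (P : ProjectiveResolution X) :
    P.complex.d 1 0 ≫ aug P = 0 := P.complex_d_comp_π_f_zero

lemma lift_aug {X Y : ModuleCat.{u} R} (f : X ⟶ Y) (P : ProjectiveResolution X)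
    (Q : ProjectiveResolution Y) :
    (ProjectiveResolution.lift f P Q).f 0 ≫ aug Q = aug P ≫ f :=
  ProjectiveResolution.lift_commutes_zero f P Q

/-- a lift of the projection `R/a^m → R/a^n`. -/
def IsLift (a : Ideal R) {m n : ℕ} (h : n ≤ m)
    (φ : (PP a m).complex ⟶ (PP a n).complex) : Prop :=
  φ.f 0 ≫ aug (PP a n) = aug (PP a m) ≫ q a h

lemma isLift_exists (a : Ideal R) {m n : ℕ} (h : n ≤ m) : ∃ φ, IsLift a h φ := by
  refine ⟨ProjectiveResolution.lift (q a h) (PP a m) (PP a n), lift_aug _ _ _⟩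

lemma q_comp (a : Ideal R) {k m n : ℕ} (h : n ≤ m) (h' : m ≤ k) :
    q a h' ≫ q a h = q a (h.trans h') := by
  ext
  rfl

lemma IsLift.comp {a : Ideal R} {k m n : ℕ} {h : n ≤ m} {h' : m ≤ k} {φ ψ}
    (hφ : IsLift a h φ) (hψ : IsLift a h' ψ) : IsLift a (h.trans h') (ψ ≫ φ) := by
  unfold IsLift at *
  rw [HomologicalComplex.comp_f, Category.assoc, hφ, ← Category.assoc, hψ, Category.assoc, q_comp]

def Robust (a p : Ideal R) {M : ModuleCat.{u} R} {i n : ℕ}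
    (f : (PP a n).complex.X i ⟶ M) : Prop :=
  (PP a n).complex.d (i + 1) i ≫ f = 0 ∧
  ∀ (m : ℕ) (h : n ≤ m) (φ : (PP a m).complex ⟶ (PP a n).complex), IsLift a h φ →
    ∀ s ∉ p, ∀ (j : ℕ) (g : (PP a m).complex.X j ⟶ M),
      (PP a m).complex.d i j ≫ g ≠ s • (φ.f i ≫ f)

lemma Robust.mem_support {a : Ideal R} {p : PrimeSpectrum R} {M : ModuleCat.{u} R} {i n : ℕ}
    {f : (PP a n).complex.X i ⟶ M} (hf : Robust a p.asIdeal f) :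
    p ∈ Module.support R ((localCohomology a i).obj M) := by
  obtain ⟨e, he⟩ := Rep.of_cocycle hf.1
  rw [Module.mem_support_iff']
  refine ⟨(ι a M i n).hom e, fun s hs h0 => ?_⟩
  rw [← map_smul] at h0
  obtain ⟨m, hm, h1⟩ := ι_zero a M i _ h0
  obtain ⟨φ, hφ⟩ := isLift_exists a hm
  have h2 := Rep.nat hφ (he.smul s)
  rw [h1] at h2
  obtain ⟨j, g, hg⟩ := h2.coboundary
  refine hf.2 m hm φ hφ s hs j g ?_
  rw [hg, Linear.comp_smul]

lemma robust_step {a : Ideal R} (p : PrimeSpectrum R) {M : ModuleCat.{u} R} (x s : R)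
    (hs : s ∉ p.asIdeal) (hx : ∀ m : M, x • m = 0 → s • m = 0) {i n : ℕ}
    {Q : ModuleCat.{u} R} (π : M ⟶ Q) [Epi π] (w : (x • 𝟙 M) ≫ π = 0)
    (hex : (ShortComplex.mk (x • 𝟙 M) π w).Exact)
    {f : (PP a n).complex.X i ⟶ Q} (hf : Robust a p.asIdeal f) :
    ∃ (i n : ℕ) (f : (PP a n).complex.X i ⟶ M), Robust a p.asIdeal f := by
  have kill : ∀ (Z : ModuleCat.{u} R) (g : Z ⟶ M), x • g = 0 → s • g = 0 := by
    intro Z g hg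
    ext z
    exact hx _ (LinearMap.congr_fun (congrArg ModuleCat.Hom.hom hg) z)
  have zero : ∀ (Z : ModuleCat.{u} R) (g : Z ⟶ M), (x • g) ≫ π = 0 := by
    intro Z g
    have : x • g = g ≫ (x • 𝟙 M) := by rw [Linear.comp_smul, Category.comp_id]
    rw [this, Category.assoc, w, comp_zero]
  let f' : (PP a n).complex.X i ⟶ M := Projective.factorThru f π
  have hf' : f' ≫ π = f := Projective.factorThru_comp _ _
  have h1 : ((PP a n).complex.d (i + 1) i ≫ f') ≫ π = 0 := by
    rw [Category.assoc, hf', hf.1]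
  let g : (PP a n).complex.X (i + 1) ⟶ M := hex.liftFromProjective _ h1
  have hg : x • g = (PP a n).complex.d (i + 1) i ≫ f' := by
    have := hex.liftFromProjective_comp _ h1
    rw [← this]
    exact (Linear.comp_smul _ _ _ _ _ _).trans (by rw [Category.comp_id]) |>.symm
  have hcoc : (PP a n).complex.d (i + 2) (i + 1) ≫ (s • g) = 0 := by
    rw [Linear.comp_smul]
    apply kill
    rw [← Linear.comp_smul, hg, ← Category.assoc, HomologicalComplex.d_comp_d, zero_comp]
  by_cases hr : Robust a p.asIdeal (s • g)
  · exact ⟨_, _, _, hr⟩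
  have hr' : ∃ (m : ℕ) (h : n ≤ m) (φ : (PP a m).complex ⟶ (PP a n).complex), IsLift a h φ ∧
    ∃ t ∉ p.asIdeal, ∃ (j : ℕ) (g' : (PP a m).complex.X j ⟶ M),
      (PP a m).complex.d (i + 1) j ≫ g' = t • (φ.f (i + 1) ≫ (s • g)) := by
    by_contra hcon
    push Not at hcon
    exact hr ⟨hcoc, hcon⟩
  obtain ⟨m, hm, φ, hφ, t, ht, j, g', hg'⟩ := hr'
  obtain ⟨k, hk⟩ : ∃ k : (PP a m).complex.X i ⟶ M,
      (PP a m).complex.d (i + 1) i ≫ k = t • (φ.f (i + 1) ≫ (s • g)) := by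
    by_cases hj : j = i
    · subst hj; exact ⟨g', hg'⟩
    · refine ⟨0, ?_⟩
      rw [← hg', (PP a m).complex.shape (i + 1) j (by simpa using hj), zero_comp, comp_zero]
  let e : (PP a m).complex.X i ⟶ M := (t * s) • (φ.f i ≫ f') - x • k
  have he : e ≫ π = (t * s) • (φ.f i ≫ f) := by
    have h0 := zero _ k
    have : e ≫ π =
      (t * s) • (φ.f i ≫ f' ≫ π) - (x • k) ≫ π := by
      refine (Preadditive.sub_comp _ _ _).trans ?_
      congr 1
      exact (Linear.smul_comp _ _ _ _ _ _).trans (by rw [Category.assoc])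
    rw [this, h0, sub_zero, hf']
  refine ⟨i, m, e, ?_, ?_⟩
  · rw [Preadditive.comp_sub, Linear.comp_smul, Linear.comp_smul, hk, ← Category.assoc,
      ← φ.comm, Category.assoc, ← hg, Linear.comp_smul, Linear.comp_smul, smul_smul, smul_smul,
      smul_smul, sub_eq_zero]
    congr 1
    ring
  · intro m' hm' ψ hψ r hr j c hc
    refine hf.2 m' _ _ (hφ.comp hψ) (r * (t * s)) ?_ j (c ≫ π) ?_
    · exact fun h => (p.2.mem_or_mem h).elim hr fun h => (p.2.mem_or_mem h).elim ht hs
    · rw [← Category.assoc, hc]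
      refine (Linear.smul_comp _ _ _ _ _ _).trans ?_
      rw [Category.assoc, he, Linear.comp_smul, smul_smul, HomologicalComplex.comp_f,
        Category.assoc]

lemma robust_zero {a : Ideal R} (p : PrimeSpectrum R) {M : ModuleCat.{u} R} (m : M)
    (ham : ∀ r ∈ a, r • m = 0) (hm : ∀ s ∉ p.asIdeal, s • m ≠ 0) :
    ∃ (i n : ℕ) (f : (PP a n).complex.X i ⟶ M), Robust a p.asIdeal f := by
  let u : ModuleCat.of R (R ⧸ a ^ 1) ⟶ M := ModuleCat.ofHom
    (Submodule.liftQ _ (LinearMap.toSpanSingleton R M m) (by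
      intro r hr; rw [pow_one] at hr; exact ham r hr))
  have hd : (PP a 1).complex.d 1 0 ≫ aug (PP a 1) = 0 := d_aug _
  refine ⟨0, 1, aug (PP a 1) ≫ u, ?_, ?_⟩
  · rw [← Category.assoc]
    exact (congrArg (· ≫ u) hd).trans zero_comp
  · intro k hk φ hφ s hs j g hg
    rw [HomologicalComplex.shape _ _ _ (by simp), zero_comp, ← Category.assoc, hφ, Category.assoc]
      at hg
    have hepi : Epi (aug (PP a k)) := inferInstance
    have h2 : s • (q a hk ≫ u) = 0 := by
      rw [← cancel_epi (aug (PP a k))]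
      refine (Linear.comp_smul _ _ _ _ _ _).trans ?_
      rw [← hg, comp_zero]
    have h3 := LinearMap.congr_fun (congrArg ModuleCat.Hom.hom h2) (Ideal.Quotient.mk _ 1)
    have h4 : s • ((1 : R) • m) = 0 := h3
    exact hm s hs (by rwa [one_smul] at h4)

lemma exists_regular [IsNoetherianRing R] (a : Ideal R) (p : PrimeSpectrum R)
    (M : Type u) [AddCommGroup M] [Module R M] [Module.Finite R M]
    (H : ∀ m : M, (∀ r ∈ a, r • m = 0) → ∃ s ∉ p.asIdeal, s • m = 0) :
    ∃ x ∈ a, ∃ s ∉ p.asIdeal, ∀ m : M, x • m = 0 → s • m = 0 := by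
  let S : Set (Ideal R) := {q | q ∈ associatedPrimes R M ∧ q ≤ p.asIdeal}
  have hS : S.Finite := (associatedPrimes.finite R M).subset fun q hq => hq.1
  have key : ¬ ((a : Set R) ⊆ ⋃ q ∈ S, (q : Set R)) := by
    rw [Ideal.subset_union_prime_finite hS ⊥ ⊥ (fun q hq _ _ => hq.1.1)]
    rintro ⟨q, hq, haq⟩
    obtain ⟨hqp, m, hm⟩ := (isAssociatedPrime_iff.1 hq.1)
    obtain ⟨s, hs, hsm⟩ := H m (fun r hr => by
      have := haq hr
      rw [hm] at this
      simpa [Submodule.mem_colon_singleton] using this)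
    apply hs
    apply hq.2
    rw [hm]
    simpa [Submodule.mem_colon_singleton] using hsm
  rw [Set.not_subset] at key
  obtain ⟨x, hxa, hx⟩ := key
  refine ⟨x, hxa, ?_⟩
  have loc : ∀ m : M, x • m = 0 → ∃ s ∉ p.asIdeal, s • m = 0 := by
    intro m hm
    by_contra hcon
    push Not at hcon
    let N := Submodule.span R {m}
    have hann : Module.annihilator R N ≤ p.asIdeal := by
      intro s hs
      by_contra hsp
      refine hcon s hsp ?_
      have := Module.mem_annihilator.1 hs ⟨m, Submodule.mem_span_singleton_self m⟩
      exact congrArg Subtype.val this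
    obtain ⟨q, hq, hqp⟩ := Ideal.exists_minimalPrimes_le hann
    have hqA : q ∈ associatedPrimes R N :=
      Module.associatedPrimes.minimalPrimes_annihilator_subset_associatedPrimes R N hq
    have hqM : q ∈ associatedPrimes R M :=
      associatedPrimes.subset_of_injective (f := N.subtype) N.injective_subtype hqA
    apply hx
    refine Set.mem_biUnion (show q ∈ S from ⟨hqM, hqp⟩) ?_
    apply hq.1.2
    rw [Module.mem_annihilator]
    rintro ⟨n, hn⟩
    obtain ⟨c, rfl⟩ := Submodule.mem_span_singleton.1 hn
    ext
    simp [smul_comm x c m, hm]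
  let K := LinearMap.ker (LinearMap.lsmul R M x)
  have hK : p ∉ Module.support R K := by
    rw [Module.notMem_support_iff']
    rintro ⟨m, hm⟩
    obtain ⟨s, hs, h⟩ := loc m (by simpa [K] using hm)
    exact ⟨s, hs, Subtype.ext h⟩
  rw [Module.mem_support_iff_of_finite, SetLike.not_le_iff_exists] at hK
  obtain ⟨s, hs, hsp⟩ := hK
  refine ⟨s, hsp, fun m hm => ?_⟩
  exact congrArg Subtype.val (Module.mem_annihilator.1 hs ⟨m, by simpa [K] using hm⟩)

open Pointwise in
lemma exists_robust [IsNoetherianRing R] (a : Ideal R) (p : PrimeSpectrum R)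
    (hap : a ≤ p.asIdeal) : ∀ (I : Ideal R) (M : Type u) [AddCommGroup M] [Module R M]
    [Module.Finite R M], Module.annihilator R M = I → p ∈ Module.support R M →
    ∃ (i n : ℕ) (f : (PP a n).complex.X i ⟶ ModuleCat.of R M), Robust a p.asIdeal f := by
  intro I
  induction I using WellFoundedGT.induction with
  | ind I ih =>
  intro M _ _ _ hI hp
  by_cases H : ∀ m : M, (∀ r ∈ a, r • m = 0) → ∃ s ∉ p.asIdeal, s • m = 0
  · obtain ⟨x, hxa, s, hs, hxs⟩ := exists_regular a p M H
    have hxI : x ∉ Module.annihilator R M := by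
      intro hx
      apply hs
      refine Module.annihilator_le_of_mem_support hp ?_
      rw [Module.mem_annihilator] at hx ⊢
      exact fun m => hxs m (hx m)
    have hle : Module.annihilator R M ≤ Module.annihilator R (QuotSMulTop x M) :=
      LinearMap.annihilator_le_of_surjective (Submodule.mkQ _) (Submodule.mkQ_surjective _)
    have hxQ : x ∈ Module.annihilator R (QuotSMulTop x M) := by
      rw [Module.mem_annihilator]
      intro m
      obtain ⟨m, rfl⟩ := Submodule.mkQ_surjective (x • (⊤ : Submodule R M)) m
      exact (Submodule.Quotient.mk_eq_zero _).2
        (Submodule.smul_mem_pointwise_smul (m : M) x (⊤ : Submodule R M) trivial)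
    obtain ⟨i, n, f, hf⟩ := ih (Module.annihilator R (QuotSMulTop x M))
      (lt_of_le_of_ne (hI ▸ hle) (fun h => hxI (by rw [hI, h]; exact hxQ)))
      (QuotSMulTop x M) rfl
      (by rw [Module.support_quotSMulTop]; exact ⟨hp, by simpa using hap hxa⟩)
    let S := (ModuleCat.of R M).smulShortComplex x
    have hepi : Epi S.g := by
      rw [ModuleCat.epi_iff_surjective]
      exact Submodule.mkQ_surjective _
    exact @robust_step R _ a p (ModuleCat.of R M) x s hs hxs i n
      (ModuleCat.of R (QuotSMulTop x M)) S.g hepi S.zero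
      ((ModuleCat.of R M).smulShortComplex_exact x) f hf
  · push Not at H
    obtain ⟨m, h1, h2⟩ := H
    exact robust_zero p (M := ModuleCat.of R M) m h1 h2

lemma smul_ext_eq_zero {a : Ideal R} {M : ModuleCat.{u} R} {i n : ℕ} {r : R} (hr : r ∈ a ^ n)
    (e : ((Ext R (ModuleCat R) i).obj (op (ModuleCat.of R (R ⧸ a ^ n)))).obj M) : r • e = 0 := by
  obtain ⟨f, hf⟩ := Rep.exists (P := PP a n) e
  have h0 : r • 𝟙 (ModuleCat.of R (R ⧸ a ^ n)) = 0 := by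
    ext
    exact (Ideal.Quotient.eq_zero_iff_mem (I := a ^ n) (a := r * 1)).2 (by simpa using hr)
  have c1 : (r • 𝟙 (PP a n).complex : (PP a n).complex ⟶ _).f 0 ≫ aug (PP a n) =
      aug (PP a n) ≫ (r • 𝟙 (ModuleCat.of R (R ⧸ a ^ n))) := by
    refine (Linear.smul_comp _ _ _ _ _ _).trans (Eq.trans ?_ (Linear.comp_smul _ _ _ _ _ _).symm)
    rw [Category.comp_id]
    exact congrArg (r • ·) (Category.id_comp _)
  have c2 : (0 : (PP a n).complex ⟶ (PP a n).complex).f 0 ≫ aug (PP a n) =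
      aug (PP a n) ≫ (r • 𝟙 (ModuleCat.of R (R ⧸ a ^ n))) := by
    rw [h0, comp_zero]; exact zero_comp
  have r1 := Rep.nat c1 hf
  have r2 := Rep.nat c2 hf
  rw [HomologicalComplex.zero_f, zero_comp] at r2
  have z := Rep.eq_zero r2
  rw [z] at r1
  have r3 : Rep (PP a n) (r • f) 0 := by
    have : (r • 𝟙 (PP a n).complex : (PP a n).complex ⟶ _).f i ≫ f = r • f := by
      refine (Linear.smul_comp _ _ _ _ _ _).trans ?_
      exact congrArg (r • ·) (Category.id_comp _)
    rwa [this] at r1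
  exact Rep.unique (hf.smul r) r3

lemma smul_ext_eq_zero' {X M : ModuleCat.{u} R} {i : ℕ} {r : R} (hr : r ∈ Module.annihilator R M)
    (e : ((Ext R (ModuleCat R) i).obj (op X)).obj M) : r • e = 0 := by
  obtain ⟨f, hf⟩ := Rep.exists (P := projectiveResolution X) e
  apply Rep.eq_zero (P := projectiveResolution X)
  convert hf.smul r
  ext z
  exact (Module.mem_annihilator.1 hr _).symm

end LC

/-- the union of the supports of the local cohomology modules of a
finitely generated module `L` with respect to `a` equals the support of `L/aL`. -/
theorem stmt0 [IsNoetherianRing R] (a : Ideal R)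
    (L : Type u) [AddCommGroup L] [Module R L] [Module.Finite R L] :
    (⋃ i : ℕ, Module.support R (localCoh R a i L)) =
      Module.support R (L ⧸ (a • ⊤ : Submodule R L)) := by
  rw [Module.support_quotient]
  ext p
  rw [Set.mem_iUnion]
  constructor
  · rintro ⟨i, hi⟩
    rw [Module.mem_support_iff'] at hi
    obtain ⟨m, hm⟩ := hi
    obtain ⟨n, e, he⟩ := LC.ι_surj a (ModuleCat.of R L) i m
    have key : ∀ r : R, r • e = 0 → r ∈ p.asIdeal := by
      intro r hr
      by_contra hrp
      refine hm r hrp ?_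
      rw [← he]
      exact (map_smul (LC.ι a (ModuleCat.of R L) i n).hom r e).symm.trans
        (by rw [hr]; exact map_zero _)
    refine ⟨?_, ?_⟩
    · rw [Module.mem_support_iff_of_finite]
      exact fun r hr => key r (LC.smul_ext_eq_zero' (M := ModuleCat.of R L) hr e)
    · exact p.2.le_of_pow_le (n := n) fun r hr => key r (LC.smul_ext_eq_zero hr e)
  · rintro ⟨hp, hap⟩
    obtain ⟨i, n, f, hf⟩ := LC.exists_robust a p hap _ L rfl hp
    exact ⟨i, hf.mem_support⟩
end

section
/- Let 𝔞 be an ideal of R and M an 𝔞-relative Cohen-Macaulay R-module with M ≠ 𝔞M, and set c = cd(𝔞,M). Then for every prime 𝔭 ∈ Supp_R(M/𝔞M), the localization M_𝔭 is an 𝔞R_𝔭-relative Cohen-Macaulay R_𝔭-module with cd(𝔞R_𝔭, M_𝔭) = c. -/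
open CategoryTheory Opposite
open scoped TensorProduct

universe u

variable (R : Type u) [CommRing R]

namespace RelCM

section cmp
open CategoryTheory Limits Opposite

variable {R : Type u} [CommRing R]

/-- the functor Hom(-,Y) -/
noncomputable abbrev FY (Y : ModuleCat.{u} R) : ModuleCat.{u} R ⥤ (ModuleCat.{u} R)ᵒᵖ :=
  ((linearYoneda R (ModuleCat.{u} R)).obj Y).rightOp

noncomputable abbrev KY {X : ModuleCat.{u} R} (P : ProjectiveResolution X) (Y : ModuleCat.{u} R) :
    ChainComplex (ModuleCat.{u} R)ᵒᵖ ℕ :=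
  ((FY Y).mapHomologicalComplex _).obj P.complex

noncomputable def fn {X : ModuleCat.{u} R} (P : ProjectiveResolution X) (Y : ModuleCat.{u} R)
    (n : ℕ) (z : ((KY P Y).opcycles n).unop) : P.complex.X n ⟶ Y :=
  ((KY P Y).pOpcycles n).unop z

noncomputable def cls {X : ModuleCat.{u} R} (P : ProjectiveResolution X) (Y : ModuleCat.{u} R)
    (n : ℕ) (z : ((KY P Y).opcycles n).unop) :
    (((Ext R (ModuleCat R) n).obj (op X)).obj Y : ModuleCat.{u} R) :=
  ((P.isoLeftDerivedObj (FY Y) n).hom.unop) (((KY P Y).homologyι n).unop z)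

def OldRep {X : ModuleCat.{u} R} (P : ProjectiveResolution X) (Y : ModuleCat.{u} R)
    (n : ℕ) (f : P.complex.X n ⟶ Y) (ξ : ((Ext R (ModuleCat R) n).obj (op X)).obj Y) : Prop :=
  ∃ z, fn P Y n z = f ∧ cls P Y n z = ξ

variable {X : ModuleCat.{u} R} (P : ProjectiveResolution X) (Y : ModuleCat.{u} R) (n : ℕ)

lemma oldRep_surj (ξ : ((Ext R (ModuleCat R) n).obj (op X)).obj Y) :
    ∃ f, OldRep P Y n f ξ := by
  have h : Epi (((KY P Y).homologyι n).unop) := inferInstance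
  rw [ModuleCat.epi_iff_surjective] at h
  obtain ⟨z, hz⟩ := h ((P.isoLeftDerivedObj (FY Y) n).inv.unop ξ)
  refine ⟨_, z, rfl, ?_⟩
  unfold cls
  rw [hz]
  have : (P.isoLeftDerivedObj (FY Y) n).inv.unop ≫ (P.isoLeftDerivedObj (FY Y) n).hom.unop = 𝟙 _ := by
    rw [← unop_comp, Iso.hom_inv_id]; rfl
  exact ConcreteCategory.congr_hom this ξ

lemma oldRep_cocycle {f : P.complex.X n ⟶ Y} {ξ} (h : OldRep P Y n f ξ) :
    P.complex.d (n+1) n ≫ f = 0 := by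
  obtain ⟨z, rfl, rfl⟩ := h
  have := congrArg Quiver.Hom.unop ((KY P Y).d_pOpcycles (n+1) n)
  exact ConcreteCategory.congr_hom this z

lemma oldRep_exists (f : P.complex.X n ⟶ Y) (hf : P.complex.d (n+1) n ≫ f = 0) :
    ∃ ξ, OldRep P Y n f ξ := by
  have hk := ShortComplex.exact_of_g_is_cokernel
    (ShortComplex.mk _ _ ((KY P Y).d_pOpcycles (n+1) n)) ((KY P Y).opcyclesIsCokernel (n+1) n (by simp))
  have h2 := hk.unop
  rw [ShortComplex.moduleCat_exact_iff] at h2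
  obtain ⟨z, hz⟩ := h2 f hf
  exact ⟨_, z, hz, rfl⟩

lemma oldRep_zero_iff {f : P.complex.X n ⟶ Y} {ξ} (h : OldRep P Y n f ξ) (m : ℕ)
    (hm : (ComplexShape.down ℕ).next n = m) :
    ξ = 0 ↔ ∃ g : P.complex.X m ⟶ Y, P.complex.d n m ≫ g = f := by
  obtain ⟨z, rfl, rfl⟩ := h
  have hk := ShortComplex.exact_of_f_is_kernel
    (ShortComplex.mk _ _ ((KY P Y).homologyι_comp_fromOpcycles n m))
    ((KY P Y).homologyIsKernel n m hm)
  have h2 := hk.unop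
  rw [ShortComplex.moduleCat_exact_iff] at h2
  have hp : ∀ g : P.complex.X m ⟶ Y, fn P Y n (((KY P Y).fromOpcycles n m).unop g) =
      P.complex.d n m ≫ g := fun g => by
    have := congrArg Quiver.Hom.unop ((KY P Y).p_fromOpcycles n m)
    exact ConcreteCategory.congr_hom this g
  have hinj : Function.Injective ((P.isoLeftDerivedObj (FY Y) n).hom.unop) := by
    rw [← ModuleCat.mono_iff_injective]; infer_instance
  have hinj2 : Function.Injective (((KY P Y).pOpcycles n).unop) := by
    rw [← ModuleCat.mono_iff_injective]; infer_instance
  constructor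
  · intro h0
    have h1 : ((KY P Y).homologyι n).unop z = 0 := by
      apply hinj
      exact h0.trans (map_zero ((P.isoLeftDerivedObj (FY Y) n).hom.unop.hom)).symm
    obtain ⟨g, hg⟩ := h2 z h1
    refine ⟨g, (hp g).symm.trans ?_⟩
    exact congrArg _ hg
  · rintro ⟨g, hg⟩
    rw [← hp] at hg
    have hz := hinj2 hg
    rw [← hz]
    have := congrArg Quiver.Hom.unop ((KY P Y).homologyι_comp_fromOpcycles n m)
    have h3 := ConcreteCategory.congr_hom this g
    unfold cls
    have h4 : (((KY P Y).homologyι n).unop) (((KY P Y).fromOpcycles n m).unop g) = 0 := h3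
    exact (congrArg _ h4).trans (map_zero ((P.isoLeftDerivedObj (FY Y) n).hom.unop.hom))

lemma oldRep_map {X' : ModuleCat.{u} R} {P' : ProjectiveResolution X'} {g : X' ⟶ X} 
    (φ : P'.Hom P g) {f : P.complex.X n ⟶ Y} {ξ} (h : OldRep P Y n f ξ) :
    OldRep P' Y n (φ.hom.f n ≫ f) (((Ext R (ModuleCat R) n).map g.op).app Y ξ) := by
  obtain ⟨z, rfl, rfl⟩ := h
  let ψ : KY P' Y ⟶ KY P Y := ((FY Y).mapHomologicalComplex _).map φ.hom
  refine ⟨(HomologicalComplex.opcyclesMap ψ n).unop z, ?_, ?_⟩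
  · have := congrArg Quiver.Hom.unop (HomologicalComplex.p_opcyclesMap ψ n)
    exact ConcreteCategory.congr_hom this z
  · have h1 := congrArg Quiver.Hom.unop (HomologicalComplex.homologyι_naturality ψ n)
    have h2 := congrArg Quiver.Hom.unop (ProjectiveResolution.isoLeftDerivedObj_hom_naturality g P' P φ.hom 
      (by simpa using φ.hom_f_zero_comp_π_f_zero) (FY Y) n)
    have h3 := ConcreteCategory.congr_hom h2 (((KY P Y).homologyι n).unop z)
    have h4 := ConcreteCategory.congr_hom h1 z
    refine Eq.trans ?_ h3.symm
    exact congrArg _ h4.symm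

lemma newRep_zero_iff (f : P.complex.X n ⟶ Y) (hf : P.complex.d (n+1) n ≫ f = 0) (m : ℕ)
    (hm : (ComplexShape.down ℕ).next n = m) :
    P.extMk f (n+1) rfl hf = 0 ↔ ∃ g : P.complex.X m ⟶ Y, P.complex.d n m ≫ g = f := by
  cases n with
  | succ k =>
    obtain rfl : k = m := by simpa using hm
    exact P.extMk_eq_zero_iff f _ rfl hf k rfl
  | zero =>
    obtain rfl : 0 = m := by simpa using hm
    have hd : P.complex.d 0 0 = 0 := P.complex.shape _ _ (by simp)
    rw [hd]
    simp only [zero_comp]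
    constructor
    · intro h
      refine ⟨0, ?_⟩
      simp only [← P.extEquivCohomologyClass.apply_eq_iff_eq,
        ProjectiveResolution.extEquivCohomologyClass_extMk,
        ProjectiveResolution.extEquivCohomologyClass_zero,
        CochainComplex.HomComplex.CohomologyClass.mk_eq_zero_iff] at h
      rw [CochainComplex.HomComplex.Cocycle.toSingleMk_mem_coboundaries_iff _ _ _ _ _ 1 (by simp)] at h
      obtain ⟨g, hg⟩ := h
      have hz : IsZero (P.cochainComplex.X 1) := P.cochainComplex.isZero_of_isStrictlyLE 0 1 (by simp)
      rw [hz.eq_of_src g 0, comp_zero] at hg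
      rw [← cancel_epi (P.cochainComplexXIso (-(0:ℕ)) 0 rfl).hom, ← hg, comp_zero]
    · rintro ⟨_, h⟩
      subst h
      simp

/-- comparison relation between the two models of Ext -/
def CmpRel {X : ModuleCat.{u} R} (P : ProjectiveResolution X) (Y : ModuleCat.{u} R) (n : ℕ)
    (ξ : ((Ext R (ModuleCat R) n).obj (op X)).obj Y) (η : Abelian.Ext X Y n) : Prop :=
  ∃ (f : P.complex.X n ⟶ Y) (hf : P.complex.d (n+1) n ≫ f = 0),
    OldRep P Y n f ξ ∧ P.extMk f (n+1) rfl hf = η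

lemma cmp_left (ξ : ((Ext R (ModuleCat R) n).obj (op X)).obj Y) : ∃ η, CmpRel P Y n ξ η := by
  obtain ⟨f, hf⟩ := oldRep_surj P Y n ξ
  exact ⟨_, f, oldRep_cocycle P Y n hf, hf, rfl⟩

lemma cmp_right (η : Abelian.Ext X Y n) : ∃ ξ, CmpRel P Y n ξ η := by
  obtain ⟨f, hf, rfl⟩ := P.extMk_surjective η _ rfl
  obtain ⟨ξ, hξ⟩ := oldRep_exists P Y n f hf
  exact ⟨ξ, f, hf, hξ, rfl⟩

lemma cmp_zero {ξ : ((Ext R (ModuleCat R) n).obj (op X)).obj Y} {η : Abelian.Ext X Y n}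
    (h : CmpRel P Y n ξ η) : ξ = 0 ↔ η = 0 := by
  obtain ⟨f, hf, h1, rfl⟩ := h
  rw [oldRep_zero_iff P Y n h1 _ rfl, newRep_zero_iff P Y n f hf _ rfl]

lemma cmp_map {X' : ModuleCat.{u} R} {P' : ProjectiveResolution X'} (g : X' ⟶ X)
    {ξ : ((Ext R (ModuleCat R) n).obj (op X)).obj Y} {η : Abelian.Ext X Y n}
    (h : CmpRel P Y n ξ η) :
    CmpRel P' Y n (((Ext R (ModuleCat R) n).map g.op).app Y ξ)
      ((Abelian.Ext.mk₀ g).comp η (zero_add n)) := by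
  obtain ⟨f, hf, h1, rfl⟩ := h
  let φ : P'.Hom P g := ⟨ProjectiveResolution.lift g P' P, by
    simpa using ProjectiveResolution.lift_commutes_zero g P' P⟩
  exact ⟨_, _, oldRep_map P Y n φ h1, (ProjectiveResolution.mk₀_comp_extMk f _ rfl hf φ).symm⟩

end cmp

section lc
open CategoryTheory Limits Opposite

variable {R : Type u} [CommRing R]

lemma nontrivial_relExt_iff (a : Ideal R) (i : ℕ) (M : Type u) [AddCommGroup M] [Module R M] :
    Nontrivial (relExt R a i M) ↔
      Nontrivial (Abelian.Ext (ModuleCat.of R (R ⧸ a)) (ModuleCat.of R M) i) := by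
  let P := projectiveResolution (ModuleCat.of R (R ⧸ a))
  rw [nontrivial_iff_exists_ne 0, nontrivial_iff_exists_ne 0]
  constructor
  · rintro ⟨ξ, hξ⟩
    obtain ⟨η, h⟩ := cmp_left P (ModuleCat.of R M) i ξ
    exact ⟨η, fun h0 => hξ ((cmp_zero P _ _ h).2 h0)⟩
  · rintro ⟨η, hη⟩
    obtain ⟨ξ, h⟩ := cmp_right P (ModuleCat.of R M) i η
    exact ⟨ξ, fun h0 => hη ((cmp_zero P _ _ h).1 h0)⟩

/-- transition map `R/a^m → R/a^n`. -/
noncomputable def tr (a : Ideal R) {n m : ℕ} (h : n ≤ m) :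
    ModuleCat.of R (R ⧸ a ^ m) ⟶ ModuleCat.of R (R ⧸ a ^ n) :=
  ModuleCat.ofHom (Submodule.mapQ _ _ LinearMap.id (Ideal.pow_le_pow_right h))

/-- vanishing of `H^i_a(M)`, elementwise. -/
def LC (a : Ideal R) (i : ℕ) (M : ModuleCat.{u} R) : Prop :=
  ∀ (n : ℕ) (ξ : Abelian.Ext (ModuleCat.of R (R ⧸ a ^ n)) M i),
    ∃ (m : ℕ) (h : n ≤ m), (Abelian.Ext.mk₀ (tr a h)).comp ξ (zero_add i) = 0

lemma nontrivial_localCoh_iff (a : Ideal R) (i : ℕ) (M : Type u) [AddCommGroup M] [Module R M] :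
    Nontrivial (localCoh R a i M) ↔ ¬ LC a i (ModuleCat.of R M) := by
  let D := localCohomology.diagram (localCohomology.idealPowersDiagram a) i
  let G := D ⋙ (evaluation _ _).obj (ModuleCat.of R M)
  have hc : IsColimit (((evaluation _ _).obj (ModuleCat.of R M)).mapCocone (colimit.cocone D)) :=
    isColimitOfPreserves _ (colimit.isColimit D)
  change Nontrivial (((evaluation _ _).obj (ModuleCat.of R M)).mapCocone (colimit.cocone D)).pt ↔ _
  generalize (((evaluation _ _).obj (ModuleCat.of R M)).mapCocone (colimit.cocone D)) = Dc at hc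
  rw [← not_subsingleton_iff_nontrivial, not_iff_not]
  have : PreservesFilteredColimitsOfSize.{0, 0} (forget (ModuleCat.{u} R)) :=
    preservesSmallestFilteredColimits_of_preservesFilteredColimits _
  let P : ∀ n : ℕ, ProjectiveResolution (ModuleCat.of R (R ⧸ a ^ n)) := fun n =>
    projectiveResolution _
  have key : ∀ (n : ℕ) (y : G.obj (op (op n))), Dc.ι.app _ y = 0 ↔
      ∃ (m : ℕ) (h : n ≤ m), ((Ext R (ModuleCat R) i).map (tr a h).op).app (ModuleCat.of R M) y = 0 := by
    intro n y
    rw [← map_zero (Dc.ι.app (op (op n))).hom]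
    constructor
    · intro h0
      obtain ⟨k, f, g, hfg⟩ := Concrete.isColimit_exists_of_rep_eq G hc _ _ h0
      exact ⟨k.unop.unop, f.unop.unop.down.down, hfg.trans (map_zero (G.map g).hom)⟩
    · rintro ⟨m, h, h1⟩
      have f : op (op n) ⟶ op (op m) := (homOfLE h).op.op
      exact Concrete.isColimit_rep_eq_of_exists G _ _ ⟨op (op m), f, f,
        h1.trans (map_zero (G.map f).hom).symm⟩
  constructor
  · intro hs n η
    obtain ⟨ξ, h⟩ := cmp_right (P n) (ModuleCat.of R M) i η
    obtain ⟨m, hm, h1⟩ := (key n ξ).1 (hs.elim _ _)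
    exact ⟨m, hm, (cmp_zero _ _ _ (cmp_map (P n) _ _ (P' := P m) (tr a hm) h)).1 h1⟩
  · intro hL
    refine subsingleton_of_forall_eq 0 fun x => ?_
    obtain ⟨j, y, rfl⟩ := Concrete.isColimit_exists_rep G hc x
    obtain ⟨η, h⟩ := cmp_left (P j.unop.unop) (ModuleCat.of R M) i y
    obtain ⟨m, hm, h1⟩ := hL _ η
    exact (key j.unop.unop y).2 ⟨m, hm, (cmp_zero _ _ _ (cmp_map (P _) _ _ (P' := P m) (tr a hm) h)).2 h1⟩

end lc
end RelCM

namespace RelCM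
section lc2
open CategoryTheory Limits Opposite

variable {R : Type u} [CommRing R] (a : Ideal R)

lemma tr_comp {n m k : ℕ} (h : n ≤ m) (h' : m ≤ k) : tr a h' ≫ tr a h = tr a (h.trans h') := by
  ext; rfl

lemma tr_comp_ext {n m k : ℕ} (h : n ≤ m) (h' : m ≤ k) {i : ℕ} {M : ModuleCat.{u} R}
    (ξ : Abelian.Ext (ModuleCat.of R (R ⧸ a ^ n)) M i) :
    (Abelian.Ext.mk₀ (tr a h')).comp ((Abelian.Ext.mk₀ (tr a h)).comp ξ (zero_add i)) (zero_add i) =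
      (Abelian.Ext.mk₀ (tr a (h.trans h'))).comp ξ (zero_add i) := by
  rw [Abelian.Ext.mk₀_comp_mk₀_assoc, tr_comp]

variable {a}

lemma LC.mid {S : ShortComplex (ModuleCat.{u} R)} (hS : S.ShortExact) {i : ℕ}
    (h1 : LC a i S.X₁) (h3 : LC a i S.X₃) : LC a i S.X₂ := by
  intro n ξ
  obtain ⟨m, hm, h⟩ := h3 n (ξ.comp (Abelian.Ext.mk₀ S.g) (add_zero i))
  rw [← Abelian.Ext.comp_assoc_of_third_deg_zero] at h
  obtain ⟨η, hη⟩ := Abelian.Ext.covariant_sequence_exact₂ _ hS _ h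
  obtain ⟨k, hk, h'⟩ := h1 m η
  refine ⟨k, hm.trans hk, ?_⟩
  rw [← tr_comp_ext a hm hk, ← hη, ← Abelian.Ext.comp_assoc_of_third_deg_zero, h',
    Abelian.Ext.zero_comp]

lemma LC.left {S : ShortComplex (ModuleCat.{u} R)} (hS : S.ShortExact) {i : ℕ}
    (h3 : LC a i S.X₃) (h2 : LC a (i+1) S.X₂) : LC a (i+1) S.X₁ := by
  intro n ξ
  obtain ⟨m, hm, h⟩ := h2 n (ξ.comp (Abelian.Ext.mk₀ S.f) (add_zero _))
  rw [← Abelian.Ext.comp_assoc_of_third_deg_zero] at h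
  obtain ⟨η, hη⟩ := Abelian.Ext.covariant_sequence_exact₁ _ hS _ h rfl
  obtain ⟨k, hk, h'⟩ := h3 m η
  refine ⟨k, hm.trans hk, ?_⟩
  rw [← tr_comp_ext a hm hk, ← hη, ← Abelian.Ext.comp_assoc _ _ _ (zero_add i) rfl (by omega), h',
    Abelian.Ext.zero_comp]

lemma LC.right {S : ShortComplex (ModuleCat.{u} R)} (hS : S.ShortExact) {i : ℕ}
    (h2 : LC a i S.X₂) (h1 : LC a (i+1) S.X₁) : LC a i S.X₃ := by
  intro n ξ
  obtain ⟨m, hm, h⟩ := h1 n (ξ.comp hS.extClass rfl)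
  rw [← Abelian.Ext.comp_assoc _ _ _ (zero_add i) rfl (by omega)] at h
  obtain ⟨η, hη⟩ := Abelian.Ext.covariant_sequence_exact₃ _ hS _ rfl h
  obtain ⟨k, hk, h'⟩ := h2 m η
  refine ⟨k, hm.trans hk, ?_⟩
  rw [← tr_comp_ext a hm hk, ← hη, ← Abelian.Ext.comp_assoc_of_third_deg_zero, h',
    Abelian.Ext.zero_comp]

lemma LC.zero_iff (M : ModuleCat.{u} R) :
    LC a 0 M ↔ ∀ n, Subsingleton (ModuleCat.of R (R ⧸ a ^ n) ⟶ M) := by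
  constructor
  · intro h n
    refine subsingleton_of_forall_eq 0 fun f => ?_
    obtain ⟨m, hm, h1⟩ := h n (Abelian.Ext.mk₀ f)
    rw [Abelian.Ext.mk₀_comp_mk₀, Abelian.Ext.mk₀_eq_zero_iff] at h1
    have : Epi (tr a hm) := by
      rw [ModuleCat.epi_iff_surjective]
      rintro ⟨x⟩
      exact ⟨Submodule.Quotient.mk x, rfl⟩
    rwa [← cancel_epi (tr a hm), comp_zero]
  · intro h n ξ
    obtain ⟨f, rfl⟩ := Abelian.Ext.addEquiv₀.symm.surjective ξ
    refine ⟨n, le_rfl, ?_⟩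
    rw [(h n).elim f 0]; simp

lemma smul_ext_eq_zero {b : Ideal R} {r : R} (hr : r ∈ b) {M : ModuleCat.{u} R} {i : ℕ}
    (ξ : Abelian.Ext (ModuleCat.of R (R ⧸ b)) M i) : r • ξ = 0 := by
  have : r • 𝟙 (ModuleCat.of R (R ⧸ b)) = 0 := by
    ext
    simp [Algebra.smul_def, Ideal.Quotient.eq_zero_iff_mem.2 hr]
  have h2 : r • ξ = (Abelian.Ext.mk₀ (r • 𝟙 (ModuleCat.of R (R ⧸ b)))).comp ξ (zero_add i) := by
    simp [Abelian.Ext.mk₀_smul]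
  rw [h2, this]; simp

lemma LC.of_bijective {x : R} (hx : x ∈ a) (M : Type u) [AddCommGroup M] [Module R M]
    (hb : Function.Bijective (fun m : M => x • m)) (i : ℕ) : LC a i (ModuleCat.of R M) := by
  intro n ξ
  refine ⟨n, le_rfl, ?_⟩
  have hiso : IsIso (x • 𝟙 (ModuleCat.of R M)) := by
    rw [ConcreteCategory.isIso_iff_bijective]
    exact hb
  suffices ξ = 0 by rw [this]; simp
  have key : ∀ η : Abelian.Ext (ModuleCat.of R (R ⧸ a ^ n)) (ModuleCat.of R M) i, x • η = 0 → η = 0 := by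
    intro η h
    have h1 : x • η = η.comp (Abelian.Ext.mk₀ (x • 𝟙 (ModuleCat.of R M))) (add_zero i) := by
      simp [Abelian.Ext.mk₀_smul]
    rw [h1] at h
    have h2 := congrArg (fun z => Abelian.Ext.comp z (Abelian.Ext.mk₀ (inv (x • 𝟙 (ModuleCat.of R M)))) (add_zero i)) h
    simpa [Abelian.Ext.comp_assoc_of_third_deg_zero] using h2
  have key2 : ∀ k : ℕ, x ^ k • ξ = 0 → ξ = 0 := by
    intro k
    induction k with
    | zero => simp
    | succ k ih => 
      intro h
      rw [pow_succ', mul_smul] at h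
      exact ih (key _ h)
  exact key2 n (smul_ext_eq_zero (Ideal.pow_mem_pow hx n) ξ)

lemma LC.of_injective (I : ModuleCat.{u} R) [Injective I] (i : ℕ) : LC a (i+1) I := by
  intro n ξ
  exact ⟨n, le_rfl, by rw [Abelian.Ext.eq_zero_of_injective ξ]; simp⟩

lemma LC.of_smul {S : ShortComplex (ModuleCat.{u} R)} (hS : S.ShortExact) {i : ℕ} {x : R} (hx : x ∈ a)
    (e : S.X₁ ≅ S.X₂) (hf : S.f = x • e.hom) (h3 : LC a i S.X₃) : LC a (i+1) S.X₁ := by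
  have key : ∀ (n : ℕ) (ξ : Abelian.Ext (ModuleCat.of R (R ⧸ a ^ n)) S.X₁ (i+1)), x • ξ = 0 →
      ∃ (m : ℕ) (h : n ≤ m), (Abelian.Ext.mk₀ (tr a h)).comp ξ (zero_add _) = 0 := by
    intro n ξ h
    have h : ξ.comp (Abelian.Ext.mk₀ S.f) (add_zero _) = 0 := by
      rw [hf, Abelian.Ext.mk₀_smul, Abelian.Ext.comp_smul, ← Abelian.Ext.smul_comp, h, Abelian.Ext.zero_comp]
    obtain ⟨η, hη⟩ := Abelian.Ext.covariant_sequence_exact₁ _ hS _ h rfl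
    obtain ⟨k, hk, h'⟩ := h3 n η
    refine ⟨k, hk, ?_⟩
    rw [← hη, ← Abelian.Ext.comp_assoc _ _ _ (zero_add i) rfl (by omega), h',
      Abelian.Ext.zero_comp]
  have key2 : ∀ (k n : ℕ) (ξ : Abelian.Ext (ModuleCat.of R (R ⧸ a ^ n)) S.X₁ (i+1)), x ^ k • ξ = 0 →
      ∃ (m : ℕ) (h : n ≤ m), (Abelian.Ext.mk₀ (tr a h)).comp ξ (zero_add _) = 0 := by
    intro k
    induction k with
    | zero => 
      intro n ξ h
      refine ⟨n, le_rfl, ?_⟩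
      rw [pow_zero, one_smul] at h
      simp [h]
    | succ k ih =>
      intro n ξ h
      rw [pow_succ', mul_smul] at h
      obtain ⟨m, hm, h1⟩ := key n _ h
      rw [Abelian.Ext.comp_smul] at h1
      obtain ⟨m', hm', h2⟩ := ih m _ h1
      exact ⟨m', hm.trans hm', by rw [← tr_comp_ext a hm hm', h2]⟩
  intro n ξ
  exact key2 n n ξ (smul_ext_eq_zero (Ideal.pow_mem_pow hx n) ξ)

end lc2
end RelCM

namespace RelCM
section tors
open CategoryTheory Limits Opposite

variable {R : Type u} [CommRing R] {a : Ideal R}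

lemma seq {M N L : Type u} [AddCommGroup M] [AddCommGroup N] [AddCommGroup L] [Module R M]
    [Module R N] [Module R L] {f : M →ₗ[R] N} {g : N →ₗ[R] L} (hf : Function.Injective f)
    (hfg : Function.Exact f g) (hg : Function.Surjective g) :
    (ModuleCat.shortComplexOfCompEqZero f g hfg.linearMap_comp_eq_zero).ShortExact :=
  ModuleCat.shortComplex_shortExact _ hfg hf hg

/-- the `a`-torsion submodule -/
def Gam (a : Ideal R) (M : Type u) [AddCommGroup M] [Module R M] : Submodule R M where
  carrier := {m | ∃ k : ℕ, ∀ r ∈ a ^ k, r • m = 0}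
  zero_mem' := ⟨0, fun r _ => smul_zero r⟩
  add_mem' := by
    rintro x y ⟨k, hk⟩ ⟨l, hl⟩
    refine ⟨max k l, fun r hr => ?_⟩
    rw [smul_add, hk r (Ideal.pow_le_pow_right (le_max_left _ _) hr),
      hl r (Ideal.pow_le_pow_right (le_max_right _ _) hr), add_zero]
  smul_mem' := by
    rintro c x ⟨k, hk⟩
    exact ⟨k, fun r hr => by rw [smul_comm, hk r hr, smul_zero]⟩

lemma mem_Gam {M : Type u} [AddCommGroup M] [Module R M] {m : M} :
    m ∈ Gam a M ↔ ∃ k : ℕ, ∀ r ∈ a ^ k, r • m = 0 := Iff.rfl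

lemma Gam_fg {M : Type u} [AddCommGroup M] [Module R M] {N : Submodule R M} (hN : N.FG)
    (h : N ≤ Gam a M) : ∃ k : ℕ, ∀ m ∈ N, ∀ r ∈ a ^ k, r • m = 0 := by
  obtain ⟨s, rfl⟩ := hN
  have : ∀ m ∈ s, ∃ k : ℕ, ∀ r ∈ a ^ k, r • m = 0 := fun m hm => h (Submodule.subset_span hm)
  choose! k hk using this
  refine ⟨s.sup k, fun m hm r hr => ?_⟩
  induction hm using Submodule.span_induction with
  | mem x hx => exact hk x hx r (Ideal.pow_le_pow_right (Finset.le_sup hx) hr)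
  | zero => simp
  | add x y _ _ hx hy => rw [smul_add, hx, hy, add_zero]
  | smul c x _ hx => rw [smul_comm, hx, smul_zero]

lemma Gam_injective [IsNoetherianRing R] (E : Type u) [AddCommGroup E] [Module R E]
    [Module.Injective R E] : Module.Injective R (Gam a E) := by
  apply Module.Baer.injective
  intro J f
  obtain ⟨k, hk⟩ : ∃ k : ℕ, ∀ m ∈ LinearMap.range f, ∀ r ∈ a ^ k, r • m = 0 := by
    apply Gam_fg
    · rw [← Submodule.map_top]
      exact (IsNoetherian.noetherian (⊤ : Submodule R J)).map _
    · rintro ⟨x, k, hk⟩ -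
      exact ⟨k, fun r hr => Subtype.ext (hk r hr)⟩
  obtain ⟨l, hl⟩ := Ideal.exists_pow_inf_eq_pow_smul a (M := R) J
  have h1 : a ^ (k + l) ⊓ J ≤ a ^ k * J := by
    have := hl (k + l) (by omega)
    rw [Nat.add_sub_cancel] at this
    simp only [smul_eq_mul, Ideal.mul_top] at this
    rw [this]
    exact Ideal.mul_mono_right inf_le_right
  let φ : J →ₗ[R] R ⧸ a ^ (k + l) := (a ^ (k + l)).mkQ ∘ₗ J.subtype
  have h2' : (a ^ k • (⊤ : Submodule R J)) ≤ LinearMap.ker f := by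
    rw [Submodule.smul_le]
    intro r hr m _
    rw [LinearMap.mem_ker, map_smul]
    exact hk _ ⟨_, rfl⟩ r hr
  have h2 : ∀ x ∈ a ^ k * J, ∀ hx : x ∈ J, f ⟨x, hx⟩ = 0 := by
    intro x hx hxJ
    have e : a ^ k * J = Submodule.map J.subtype (a ^ k • (⊤ : Submodule R J)) := by
      rw [Submodule.map_smul'', Submodule.map_top, Submodule.range_subtype, smul_eq_mul]
    rw [e] at hx
    obtain ⟨z, hz, rfl⟩ := hx
    exact h2' hz
  have h3 : LinearMap.ker φ ≤ LinearMap.ker f := by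
    rintro ⟨x, hx⟩ h
    have : x ∈ a ^ (k + l) := by simpa [φ, Ideal.Quotient.eq_zero_iff_mem] using h
    exact h2 x (h1 ⟨this, hx⟩) hx
  obtain ⟨h, hh⟩ := Module.Injective.out (R := R) (Q := E)
    ((LinearMap.ker φ).liftQ φ le_rfl)
    (LinearMap.ker_eq_bot.1 (Submodule.ker_liftQ_eq_bot _ _ _ le_rfl))
    ((Gam a E).subtype ∘ₗ (LinearMap.ker φ).liftQ f h3)
  refine ⟨(h ∘ₗ (a ^ (k + l)).mkQ).codRestrict (Gam a E) fun c => ⟨k + l, fun r hr => ?_⟩, ?_⟩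
  · rw [← map_smul]
    have : r • c ∈ a ^ (k + l) := Ideal.mul_mem_right _ _ hr
    simp only [LinearMap.comp_apply, (Submodule.Quotient.mk_eq_zero _).2 this, Submodule.mkQ_apply,
      map_zero]
  · intro x hx
    apply Subtype.ext
    exact hh (Submodule.Quotient.mk ⟨x, hx⟩)

lemma exists_torsion_embed [IsNoetherianRing R] (N : Type u) [AddCommGroup N] [Module R N]
    (hN : ∀ m : N, m ∈ Gam a N) : ∃ (E : Type u) (_ : AddCommGroup E) (_ : Module R E)
      (_ : Module.Injective R E) (_ : ∀ m : E, m ∈ Gam a E) (f : N →ₗ[R] E), Function.Injective f := by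
  let E := Injective.under (ModuleCat.of R N)
  have hE : Module.Injective R E := Module.injective_module_of_injective_object R (inj := (inferInstance : Injective (Injective.under (ModuleCat.of R N))))
  refine ⟨Gam a E, inferInstance, inferInstance, Gam_injective E, ?_,
    (Injective.ι (ModuleCat.of R N)).hom.codRestrict (Gam a E) ?_, ?_⟩
  · rintro ⟨x, k, hk⟩
    exact ⟨k, fun r hr => Subtype.ext (hk r hr)⟩
  · intro c
    obtain ⟨k, hk⟩ := hN c
    exact ⟨k, fun r hr => by rw [← map_smul, hk r hr, map_zero]⟩
  · intro x y h
    have h := congrArg Subtype.val h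
    exact (ModuleCat.mono_iff_injective (Injective.ι (ModuleCat.of R N))).1 inferInstance h

lemma tors_quot {E : Type u} [AddCommGroup E] [Module R E] (h : ∀ m : E, m ∈ Gam a E)
    (K : Submodule R E) (m : E ⧸ K) : m ∈ Gam a (E ⧸ K) := by
  obtain ⟨m, rfl⟩ := Submodule.Quotient.mk_surjective _ m
  obtain ⟨k, hk⟩ := h m
  exact ⟨k, fun r hr => by rw [← Submodule.Quotient.mk_smul, hk r hr, Submodule.Quotient.mk_zero]⟩

lemma LC.of_torsion [IsNoetherianRing R] (i : ℕ) : ∀ (N : Type u) [AddCommGroup N] [Module R N]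
    (_ : ∀ m : N, m ∈ Gam a N), LC a (i + 1) (ModuleCat.of R N) := by
  induction i with
  | zero =>
    intro N _ _ hN
    obtain ⟨E, _, _, hE, htE, f, hf⟩ := exists_torsion_embed N hN
    have hS := seq hf f.exact_map_mkQ_range (Submodule.mkQ_surjective _)
    have : Injective (ModuleCat.of R E) := Module.injective_object_of_injective_module R E
    intro n ξ
    obtain ⟨η, hη⟩ := Abelian.Ext.covariant_sequence_exact₁ _ hS ξ
      (Abelian.Ext.eq_zero_of_injective _) (zero_add 1)
    obtain ⟨φ, rfl⟩ := Abelian.Ext.addEquiv₀.symm.surjective η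
    obtain ⟨y, hy⟩ := Submodule.Quotient.mk_surjective _ (φ.hom (Ideal.Quotient.mk _ 1))
    obtain ⟨k, hk⟩ := htE y
    refine ⟨max n k, le_max_left _ _, ?_⟩
    let ψ : ModuleCat.of R (R ⧸ a ^ (max n k)) ⟶ ModuleCat.of R E :=
      ModuleCat.ofHom ((a ^ (max n k)).liftQ (LinearMap.toSpanSingleton R E y) (by
        intro r hr
        exact hk r (Ideal.pow_le_pow_right (le_max_right _ _) hr)))
    have hψ : tr a (le_max_left n k) ≫ φ = ψ ≫ ModuleCat.ofHom (LinearMap.range f).mkQ := by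
      apply ModuleCat.hom_ext
      apply Submodule.linearMap_qext
      apply LinearMap.ext_ring
      refine Eq.trans hy.symm ?_
      refine congrArg Submodule.Quotient.mk (?_ : y = (1 : R) • y)
      rw [one_smul]
    rw [← hη]
    have e1 : Abelian.Ext.addEquiv₀.symm φ = Abelian.Ext.mk₀ φ := rfl
    rw [e1, Abelian.Ext.mk₀_comp_mk₀_assoc, hψ, ← Abelian.Ext.mk₀_comp_mk₀_assoc]
    have := hS.comp_extClass
    erw [this]
    simp
  | succ i ih =>
    intro N _ _ hN
    obtain ⟨E, _, _, hE, htE, f, hf⟩ := exists_torsion_embed N hN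
    have hS := seq hf f.exact_map_mkQ_range (Submodule.mkQ_surjective _)
    have : Injective (ModuleCat.of R E) := Module.injective_object_of_injective_module R E
    exact LC.left hS (ih _ (tors_quot htE _)) (LC.of_injective (ModuleCat.of R E) _)

end tors
end RelCM

namespace RelCM
section bdd
open CategoryTheory Limits Opposite

variable {R : Type u} [CommRing R] {a : Ideal R}

/-- every element is killed by powers of elements of `t` -/
def TT (t : Set R) (N : Type u) [AddCommGroup N] [Module R N] : Prop :=
  ∀ y ∈ t, ∀ m : N, ∃ k : ℕ, y ^ k • m = 0

lemma TT.quot {t : Set R} {N : Type u} [AddCommGroup N] [Module R N] (h : TT t N)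
    (K : Submodule R N) : TT t (N ⧸ K) := by
  intro y hy m
  obtain ⟨m, rfl⟩ := Submodule.Quotient.mk_surjective _ m
  obtain ⟨k, hk⟩ := h y hy m
  exact ⟨k, by rw [← Submodule.Quotient.mk_smul, hk, Submodule.Quotient.mk_zero]⟩

lemma TT.sub {t : Set R} {N : Type u} [AddCommGroup N] [Module R N] (h : TT t N)
    (K : Submodule R N) : TT t K := by
  rintro y hy ⟨m, hm⟩
  obtain ⟨k, hk⟩ := h y hy m
  exact ⟨k, Subtype.ext hk⟩

lemma LC.bound [IsNoetherianRing R] (s : List R) : ∀ (t : Set R) (_ : ∀ x ∈ s, x ∈ a)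
    (_ : a ≤ Ideal.span ({x | x ∈ s} ∪ t)) (N : Type u) [AddCommGroup N] [Module R N]
    (_ : TT t N) (j : ℕ), LC a (s.length + j + 1) (ModuleCat.of R N) := by
  induction s with
  | nil =>
    intro t _ ht N _ _ hN j
    apply LC.of_torsion
    intro m
    have h1 : a ≤ (Ideal.torsionOf R N m).radical := by
      refine ht.trans ?_
      rw [Ideal.span_le]
      rintro y (hy | hy)
      · simp at hy
      · exact hN y hy m
    obtain ⟨k, hk⟩ := Ideal.exists_pow_le_of_le_radical_of_fg h1 (IsNoetherian.noetherian a)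
    exact ⟨k, fun r hr => hk hr⟩
  | cons x s ih =>
    intro t hs ht N _ _ hN j
    have ih' := ih (insert x t) (fun y hy => hs y (List.mem_cons_of_mem _ hy)) (by
      refine ht.trans (Ideal.span_mono ?_)
      rintro y (hy | hy)
      · rcases List.mem_cons.1 hy with rfl | hy
        · exact Or.inr (Set.mem_insert _ _)
        · exact Or.inl hy
      · exact Or.inr (Set.mem_insert_of_mem _ hy))
    let f := LocalizedModule.mkLinearMap (Submonoid.powers x) N
    have hloc : TT t (LocalizedModule (Submonoid.powers x) N) := by
      intro y hy z
      obtain ⟨⟨m, c⟩, hm⟩ := IsLocalizedModule.surj (Submonoid.powers x) f z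
      obtain ⟨k, hk⟩ := hN y hy m
      refine ⟨k, IsLocalizedModule.smul_injective f c ?_⟩
      simp only at hm ⊢
      rw [smul_comm, hm, ← map_smul, hk, map_zero, smul_zero]
    have h1 : TT (insert x t) (LinearMap.ker f) := by
      rintro y (rfl | hy)
      · rintro ⟨m, hm⟩
        obtain ⟨⟨_, k, rfl⟩, hc⟩ := (IsLocalizedModule.eq_zero_iff (Submonoid.powers y) f).1 hm
        exact ⟨k, Subtype.ext hc⟩
      · exact hN.sub _ y hy
    have h2 : TT (insert x t) (LocalizedModule (Submonoid.powers x) N ⧸ LinearMap.range f) := by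
      rintro y (rfl | hy)
      · intro z
        obtain ⟨z, rfl⟩ := Submodule.Quotient.mk_surjective _ z
        obtain ⟨⟨m, ⟨_, k, rfl⟩⟩, hm⟩ := IsLocalizedModule.surj (Submonoid.powers y) f z
        refine ⟨k, ?_⟩
        rw [← Submodule.Quotient.mk_smul, Submodule.Quotient.mk_eq_zero]
        exact ⟨m, hm.symm⟩
      · exact hloc.quot _ y hy
    have hb : Function.Bijective (fun m : LocalizedModule (Submonoid.powers x) N => x • m) := by
      have := IsLocalizedModule.map_units f (⟨x, Submonoid.mem_powers x⟩ : Submonoid.powers x)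
      exact (Module.End.isUnit_iff _).1 this
    have e : (x :: s).length + j + 1 = s.length + j + 1 + 1 := by simp; omega
    rw [e]
    have hr : LC a (s.length + j + 1 + 1) (ModuleCat.of R (LinearMap.range f)) :=
      LC.left (seq (Submodule.subtype_injective _) (LinearMap.exact_subtype_mkQ _)
        (Submodule.mkQ_surjective _)) (ih' _ h2 j) (LC.of_bijective (hs x (by simp)) _ hb _)
    exact LC.mid (seq (f := (LinearMap.ker f).subtype) (g := f.rangeRestrict)
      (Submodule.subtype_injective _) (by
        intro z
        simp [Subtype.ext_iff])
        f.surjective_rangeRestrict) (ih' _ h1 (j+1)) hr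

lemma LC.bounded [IsNoetherianRing R] (a : Ideal R) (N : Type u) [AddCommGroup N] [Module R N] :
    ∃ k : ℕ, ∀ i > k, LC a i (ModuleCat.of R N) := by
  obtain ⟨s, hs⟩ := IsNoetherian.noetherian a
  refine ⟨s.toList.length, fun i hi => ?_⟩
  obtain ⟨j, rfl⟩ := Nat.exists_eq_add_of_lt hi
  refine LC.bound s.toList ∅ ?_ ?_ N ?_ j
  · intro x hx
    rw [← hs]
    exact Submodule.subset_span (by simpa using hx)
  · simp [← hs]
  · intro y hy
    simp at hy

end bdd
end RelCM

namespace RelCM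
section good
open CategoryTheory Limits Opposite
open scoped Pointwise

variable {R : Type u} [CommRing R]

/-- there is a weakly regular sequence of length `c` in `a` -/
def WReg (a : Ideal R) : ℕ → (M : Type u) → [AddCommGroup M] → [Module R M] → Prop
  | 0, _, _, _ => True
  | c + 1, M, _, _ => ∃ x ∈ a, IsSMulRegular M x ∧ WReg a c (QuotSMulTop x M)

variable {a : Ideal R}

lemma exists_regular [IsNoetherianRing R] (M : Type u) [AddCommGroup M] [Module R M]
    [Module.Finite R M] (b : Ideal R) 
    (h : Subsingleton (ModuleCat.of R (R ⧸ b) ⟶ ModuleCat.of R M)) :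
    ∃ x ∈ b, IsSMulRegular M x := by
  have : Subsingleton ((R ⧸ b) →ₗ[R] M) :=
    (ModuleCat.homAddEquiv (M := ModuleCat.of R (R ⧸ b)) (N := ModuleCat.of R M)).symm.subsingleton
  obtain ⟨x, hx, h⟩ := IsSMulRegular.subsingleton_linearMap_iff.1 this
  rw [Ideal.annihilator_quotient] at hx
  exact ⟨x, hx, h⟩

lemma subsingleton_hom (M : Type u) [AddCommGroup M] [Module R M] (b : Ideal R) {x : R}
    (hx : x ∈ b) (hr : IsSMulRegular M x) :
    Subsingleton (ModuleCat.of R (R ⧸ b) ⟶ ModuleCat.of R M) := by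
  have : Subsingleton ((R ⧸ b) →ₗ[R] M) := by
    refine subsingleton_of_forall_eq 0 fun f => ?_
    ext
    apply hr
    simp only [LinearMap.zero_apply, LinearMap.coe_comp, Function.comp_apply, smul_zero]
    rw [← map_smul, ← map_smul, smul_eq_mul, mul_one,
      Submodule.mkQ_apply, (Submodule.Quotient.mk_eq_zero _).2 hx, map_zero]
  exact ModuleCat.homAddEquiv.subsingleton

lemma smul_top_of_quot {M : Type u} [AddCommGroup M] [Module R M] {r : R} (hr : r ∈ a)
    (h : a • (⊤ : Submodule R (QuotSMulTop r M)) = ⊤) : a • (⊤ : Submodule R M) = ⊤ := by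
  have := congrArg (Submodule.comap (Submodule.mkQ _)) h
  simpa [Submodule.comap_smul_top_of_surjective a _ (Submodule.mkQ_surjective _),
    Submodule.smul_mono_left ((Ideal.span_singleton_le_iff_mem a).mpr hr),
    ← Submodule.ideal_span_singleton_smul] using this

lemma LC.quot {M : Type u} [AddCommGroup M] [Module R M] {x : R} (hx : IsSMulRegular M x) {i : ℕ}
    (h : LC a i (ModuleCat.of R M)) (h' : LC a (i+1) (ModuleCat.of R M)) :
    LC a i (ModuleCat.of R (QuotSMulTop x M)) :=
  LC.right (S := ModuleCat.smulShortComplex (ModuleCat.of R M) x) 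
    (IsSMulRegular.smulShortComplex_shortExact (M := ModuleCat.of R M) hx) h h'

lemma smul_top_of_LC [IsNoetherianRing R] (N : Type u) [AddCommGroup N] [Module R N]
    [Module.Finite R N] (hN : ∀ i, LC a i (ModuleCat.of R N)) :
    a • (⊤ : Submodule R N) = ⊤ := by
  have key : ∀ (K : Submodule R N) (Q : Type u) [AddCommGroup Q] [Module R Q] (π : N →ₗ[R] Q)
      (_ : Function.Surjective π) (_ : LinearMap.ker π = K) (_ : ∀ i, LC a i (ModuleCat.of R Q)),
      a • (⊤ : Submodule R Q) = ⊤ := by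
    intro K
    induction K using WellFoundedGT.induction with
    | ind K ih =>
      intro Q _ _ π hπ hK hQ
      have : Module.Finite R Q := Module.Finite.of_surjective π hπ
      obtain ⟨x, hx, hr⟩ := exists_regular Q (a ^ 1) ((LC.zero_iff _).1 (hQ 0) 1)
      rw [pow_one] at hx
      have hπ' : Function.Surjective ((x • (⊤ : Submodule R Q)).mkQ ∘ₗ π) :=
        (Submodule.mkQ_surjective _).comp hπ
      by_cases hlt : K < LinearMap.ker ((x • (⊤ : Submodule R Q)).mkQ ∘ₗ π)
      · exact smul_top_of_quot hx (ih _ hlt _ _ hπ' rfl fun i => LC.quot hr (hQ i) (hQ (i+1)))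
      · have hle : K ≤ LinearMap.ker ((x • (⊤ : Submodule R Q)).mkQ ∘ₗ π) := by
          rw [← hK]; exact LinearMap.ker_le_ker_comp _ _
        have heq : LinearMap.ker ((x • (⊤ : Submodule R Q)).mkQ ∘ₗ π) = K :=
          (eq_of_le_of_not_lt hle hlt).symm
        have : ∀ q : Q, q = 0 := by
          intro q
          obtain ⟨n, rfl⟩ := hπ q
          have h1 : x • n ∈ LinearMap.ker ((x • (⊤ : Submodule R Q)).mkQ ∘ₗ π) := by
            simp only [LinearMap.mem_ker, LinearMap.comp_apply, map_smul, Submodule.mkQ_apply]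
            rw [← Submodule.Quotient.mk_smul, Submodule.Quotient.mk_eq_zero]
            exact Submodule.smul_mem_pointwise_smul _ _ _ trivial
          rw [heq, ← hK, LinearMap.mem_ker, map_smul] at h1
          exact hr (by simpa using h1)
        have : Subsingleton Q := ⟨fun p q => by rw [this p, this q]⟩
        exact Subsingleton.elim _ _
  exact key ⊥ N LinearMap.id Function.surjective_id (by simp) hN

lemma wreg_of [IsNoetherianRing R] (c : ℕ) : ∀ (M : Type u) [AddCommGroup M] [Module R M]
    [Module.Finite R M]
    (_ : ∀ i < c, Subsingleton (Abelian.Ext (ModuleCat.of R (R ⧸ a)) (ModuleCat.of R M) i)),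
    WReg a c M := by
  induction c with
  | zero =>
    intro M _ _ _ _
    trivial
  | succ c ih =>
    intro M _ _ _ h1
    obtain ⟨x, hx, hr⟩ := exists_regular M a
      (Abelian.Ext.addEquiv₀.subsingleton_congr.mp (h1 0 c.zero_lt_succ))
    refine ⟨x, hx, hr, ih _ ?_⟩
    intro i hi
    have e1 : Subsingleton (Abelian.Ext (ModuleCat.of R (R ⧸ a))
      (ModuleCat.smulShortComplex (ModuleCat.of R M) x).X₂ i) := h1 i (by omega)
    have e2 : Subsingleton (Abelian.Ext (ModuleCat.of R (R ⧸ a))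
      (ModuleCat.smulShortComplex (ModuleCat.of R M) x).X₁ (i+1)) := h1 (i+1) (by omega)
    have hS := IsSMulRegular.smulShortComplex_shortExact (M := ModuleCat.of R M) hr
    refine subsingleton_of_forall_eq 0 fun ξ => ?_
    obtain ⟨η, hη⟩ := Abelian.Ext.covariant_sequence_exact₃ _ hS ξ rfl (Subsingleton.elim _ _)
    rw [← hη, Subsingleton.elim η 0, Abelian.Ext.zero_comp]
    rfl

lemma WReg.vanish (c : ℕ) : ∀ (M : Type u) [AddCommGroup M] [Module R M] (_ : WReg a c M), ∀ i < c,
    Subsingleton (Abelian.Ext (ModuleCat.of R (R ⧸ a)) (ModuleCat.of R M) i) ∧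
      LC a i (ModuleCat.of R M) := by
  induction c with
  | zero => intro M _ _ _ i hi; omega
  | succ c ih =>
    rintro M _ _ ⟨x, hx, hr, h⟩ (_ | i) hi
    · refine ⟨Abelian.Ext.addEquiv₀.subsingleton_congr.mpr (subsingleton_hom M a hx hr), ?_⟩
      rw [LC.zero_iff]
      intro n
      exact subsingleton_hom M _ (Ideal.pow_mem_pow hx n) (hr.pow n)
    · have hS := IsSMulRegular.smulShortComplex_shortExact (M := ModuleCat.of R M) hr
      obtain ⟨h1, h2⟩ := ih _ h i (by omega)
      refine ⟨?_, LC.of_smul hS hx (Iso.refl _) rfl h2⟩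
      have h1 : Subsingleton (Abelian.Ext (ModuleCat.of R (R ⧸ a))
        (ModuleCat.smulShortComplex (ModuleCat.of R M) x).X₃ i) := h1
      refine subsingleton_of_forall_eq 0 fun ξ => ?_
      have h3 : ξ.comp (Abelian.Ext.mk₀ (x • 𝟙 (ModuleCat.of R M))) (add_zero _) = 0 := by
        rw [Abelian.Ext.mk₀_smul, Abelian.Ext.comp_smul, ← Abelian.Ext.smul_comp,
          smul_ext_eq_zero hx, Abelian.Ext.zero_comp]
      obtain ⟨η, hη⟩ := Abelian.Ext.covariant_sequence_exact₁ _ hS ξ h3 rfl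
      rw [← hη, Subsingleton.elim η 0, Abelian.Ext.zero_comp]
      rfl

lemma WReg.loc (W : Submonoid R) (S : Type u) [CommRing S] [Algebra R S] [IsLocalization W S]
    (c : ℕ) : ∀ (M N : Type u) [AddCommGroup M] [Module R M] [AddCommGroup N] [Module R N]
    [Module S N] [IsScalarTower R S N] (f : M →ₗ[R] N) [IsLocalizedModule W f] (_ : WReg a c M),
    WReg (a.map (algebraMap R S)) c N := by
  induction c with
  | zero => intros; trivial
  | succ c ih =>
    rintro M N _ _ _ _ _ _ f _ ⟨x, hx, hr, h⟩
    refine ⟨algebraMap R S x, Ideal.mem_map_of_mem _ hx, hr.of_isLocalizedModule S W f, ?_⟩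
    have h1 := ih _ _ (Submodule.toLocalizedQuotient' S W f (x • (⊤ : Submodule R M))) h
    have e : Submodule.localized' S W f (x • (⊤ : Submodule R M)) =
        algebraMap R S x • (⊤ : Submodule S N) := by
      rw [← Submodule.ideal_span_singleton_smul, Submodule.localized'_smul, Ideal.localized'_eq_map,
        Ideal.map_span, Submodule.localized'_top, Set.image_singleton,
        Submodule.ideal_span_singleton_smul]
    rw [e] at h1
    exact h1

end good
end RelCM

namespace RelCM
section lcloc
open CategoryTheory Limits Opposite

variable {R : Type u} [CommRing R] {a : Ideal R}

/-- the map `R/a^n → C` given by an element killed by `a^n` -/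
def el {C : Type u} [AddCommGroup C] [Module R C] {n : ℕ} (z : C) (hz : ∀ r ∈ a ^ n, r • z = 0) :
    ModuleCat.of R (R ⧸ a ^ n) ⟶ ModuleCat.of R C :=
  ModuleCat.ofHom ((a ^ n).liftQ (LinearMap.toSpanSingleton R C z) hz)

lemma el_one {C : Type u} [AddCommGroup C] [Module R C] {n : ℕ} (z : C)
    (hz : ∀ r ∈ a ^ n, r • z = 0) : (el z hz).hom (Submodule.Quotient.mk 1) = z :=
  one_smul R z

lemma hom_ext_one {C : ModuleCat.{u} R} {n : ℕ} {f g : ModuleCat.of R (R ⧸ a ^ n) ⟶ C}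
    (h : f.hom (Submodule.Quotient.mk 1) = g.hom (Submodule.Quotient.mk 1)) : f = g := by
  apply ModuleCat.hom_ext
  apply Submodule.linearMap_qext
  apply LinearMap.ext_ring
  exact h

lemma hom_one_kill {C : ModuleCat.{u} R} {n : ℕ} (f : ModuleCat.of R (R ⧸ a ^ n) ⟶ C) (r : R)
    (hr : r ∈ a ^ n) : r • f.hom (Submodule.Quotient.mk 1) = 0 := by
  rw [← map_smul, ← Submodule.Quotient.mk_smul, smul_eq_mul, mul_one,
    (Submodule.Quotient.mk_eq_zero _).2 hr, map_zero]

lemma LC0_iff (M : Type u) [AddCommGroup M] [Module R M] :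
    LC a 0 (ModuleCat.of R M) ↔ ∀ z ∈ Gam a M, z = 0 := by
  rw [LC.zero_iff]
  constructor
  · rintro h z ⟨n, hz⟩
    rw [← el_one z hz, (h n).elim (el z hz) 0]
    rfl
  · intro h n
    refine subsingleton_of_forall_eq 0 fun f => hom_ext_one ?_
    exact h _ ⟨n, hom_one_kill f⟩

lemma LC1_iff {M E C : Type u} [AddCommGroup M] [AddCommGroup E] [AddCommGroup C] [Module R M]
    [Module R E] [Module R C] {f : M →ₗ[R] E} {g : E →ₗ[R] C} (hf : Function.Injective f)
    (hfg : Function.Exact f g) (hg : Function.Surjective g) [hE : Module.Injective R E] :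
    LC a 1 (ModuleCat.of R M) ↔ ∀ z ∈ Gam a C, ∃ y ∈ Gam a E, g y = z := by
  have hS := seq hf hfg hg
  have : Injective (ModuleCat.of R E) := Module.injective_object_of_injective_module R E
  constructor
  · rintro h z ⟨n, hz⟩
    obtain ⟨m, hm, h1⟩ := h n ((Abelian.Ext.mk₀ (el z hz)).comp hS.extClass (zero_add 1))
    rw [Abelian.Ext.mk₀_comp_mk₀_assoc] at h1
    obtain ⟨η, hη⟩ := Abelian.Ext.covariant_sequence_exact₃ _ hS _ (zero_add 1) h1
    obtain ⟨ψ, rfl⟩ := Abelian.Ext.addEquiv₀.symm.surjective η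
    have e1 : Abelian.Ext.addEquiv₀.symm ψ = Abelian.Ext.mk₀ ψ := rfl
    rw [e1, Abelian.Ext.mk₀_comp_mk₀] at hη
    have e2 := (Abelian.Ext.mk₀_bijective _ _).1 hη
    refine ⟨ψ.hom (Submodule.Quotient.mk 1), ⟨m, hom_one_kill ψ⟩, ?_⟩
    have e3 := congrArg (fun φ => φ.hom (Submodule.Quotient.mk 1)) e2
    exact e3.trans (el_one z hz)
  · intro h n ξ
    obtain ⟨η, hη⟩ := Abelian.Ext.covariant_sequence_exact₁ _ hS ξ
      (Abelian.Ext.eq_zero_of_injective _) (zero_add 1)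
    obtain ⟨φ, rfl⟩ := Abelian.Ext.addEquiv₀.symm.surjective η
    obtain ⟨y, ⟨k, hk⟩, hy⟩ := h (φ.hom (Submodule.Quotient.mk 1)) ⟨n, hom_one_kill φ⟩
    refine ⟨max n k, le_max_left _ _, ?_⟩
    have hψ : tr a (le_max_left n k) ≫ φ =
        el y (fun r hr => hk r (Ideal.pow_le_pow_right (le_max_right n k) hr)) ≫
          ModuleCat.ofHom g := by
      apply hom_ext_one
      refine Eq.trans hy.symm ?_
      exact congrArg g (el_one y _).symm
    rw [← hη]
    have e1 : Abelian.Ext.addEquiv₀.symm φ = Abelian.Ext.mk₀ φ := rfl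
    rw [e1, Abelian.Ext.mk₀_comp_mk₀_assoc, hψ, ← Abelian.Ext.mk₀_comp_mk₀_assoc]
    have := hS.comp_extClass
    erw [this]
    simp

variable (W : Submonoid R)

lemma unif {C : Type u} [AddCommGroup C] [Module R C] {I : Ideal R} (hI : I.FG) (c : C)
    (h : ∀ r ∈ I, ∃ w ∈ W, w • r • c = 0) : ∃ w ∈ W, ∀ r ∈ I, w • r • c = 0 := by
  classical
  obtain ⟨s, rfl⟩ := hI
  have : ∀ r ∈ s, ∃ w ∈ W, w • r • c = 0 := fun r hr => h r (Submodule.subset_span hr)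
  choose! w hw hwc using this
  refine ⟨∏ r ∈ s, w r, prod_mem hw, fun r hr => ?_⟩
  induction hr using Submodule.span_induction with
  | mem x hx =>
    rw [← Finset.prod_erase_mul _ _ hx, mul_smul, hwc x hx, smul_zero]
  | zero => simp
  | add x y _ _ hx hy => rw [add_smul, smul_add, hx, hy, add_zero]
  | smul b x _ hx => rw [smul_assoc, smul_comm, hx, smul_zero]

lemma gam_loc [IsNoetherianRing R] {C : Type u} [AddCommGroup C] [Module R C]
    (z : LocalizedModule W C)
    (hz : z ∈ Gam (a.map (algebraMap R (Localization W))) (LocalizedModule W C)) :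
    ∃ c ∈ Gam a C, ∃ w : W, z = LocalizedModule.mk c w := by
  obtain ⟨n, hn⟩ := hz
  induction z using LocalizedModule.induction_on with
  | h c w =>
    obtain ⟨v, hv, h⟩ := unif W (IsNoetherian.noetherian (a ^ n)) c (by
      intro r hr
      have h1 := hn (algebraMap R _ r) (by rw [← Ideal.map_pow]; exact Ideal.mem_map_of_mem _ hr)
      rw [algebraMap_smul, LocalizedModule.smul'_mk, ← LocalizedModule.zero_mk w,
        LocalizedModule.mk_eq] at h1
      obtain ⟨u, hu⟩ := h1
      refine ⟨(u * w : W), (u * w).2, ?_⟩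
      rw [smul_zero, smul_zero] at hu
      rw [Submonoid.coe_mul, mul_smul]
      exact hu)
    refine ⟨v • c, ⟨n, fun r hr => by rw [smul_comm, h r hr]⟩, ⟨v, hv⟩ * w, ?_⟩
    exact (LocalizedModule.mk_cancel_common_left ⟨v, hv⟩ w c).symm

lemma mk_mem_gam {C : Type u} [AddCommGroup C] [Module R C] {c : C} (hc : c ∈ Gam a C) (w : W) :
    LocalizedModule.mk c w ∈ Gam (a.map (algebraMap R (Localization W))) (LocalizedModule W C) := by
  obtain ⟨n, hn⟩ := hc
  refine ⟨n, ?_⟩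
  suffices (a.map (algebraMap R (Localization W))) ^ n ≤
    Ideal.torsionOf _ _ (LocalizedModule.mk c w) from fun r hr => this hr
  rw [← Ideal.map_pow, Ideal.map_le_iff_le_comap]
  intro r hr
  rw [Ideal.mem_comap, Ideal.mem_torsionOf_iff, algebraMap_smul, LocalizedModule.smul'_mk, hn r hr,
    LocalizedModule.zero_mk]

lemma LC.loc [IsNoetherianRing R] (i : ℕ) : ∀ (M : Type u) [AddCommGroup M] [Module R M]
    (_ : LC a i (ModuleCat.of R M)), LC (a.map (algebraMap R (Localization W))) i
      (ModuleCat.of (Localization W) (LocalizedModule W M)) := by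
  induction i with
  | zero =>
    intro M _ _ h
    rw [LC0_iff] at h ⊢
    intro z hz
    obtain ⟨c, hc, w, rfl⟩ := gam_loc W z hz
    rw [h c hc, LocalizedModule.zero_mk]
  | succ i ih =>
    intro M _ _ h
    let E := Injective.under (ModuleCat.of R M)
    have hE : Module.Injective R E := Module.injective_module_of_injective_object R (inj := (inferInstance : Injective (Injective.under (ModuleCat.of R M))))
    let f : M →ₗ[R] E := (Injective.ι (ModuleCat.of R M)).hom
    have hf : Function.Injective f :=
      (ModuleCat.mono_iff_injective (Injective.ι (ModuleCat.of R M))).1 inferInstance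
    have hfg := f.exact_map_mkQ_range
    have hg := Submodule.mkQ_surjective (LinearMap.range f)
    have hf' := LocalizedModule.map_injective W f hf
    have hfg' : Function.Exact (LocalizedModule.map W f) (LocalizedModule.map W (LinearMap.range f).mkQ) :=
      LocalizedModule.map_exact W f _ hfg
    have hg' := LocalizedModule.map_surjective W _ hg
    have hE' : Module.Injective (Localization W) (LocalizedModule W E) :=
      Module.injective_of_isLocalizedModule W (LocalizedModule.mkLinearMap W E)
    cases i with
    | zero =>
      have h := (LC1_iff hf hfg hg).1 h
      refine (LC1_iff hf' hfg' hg').2 fun z hz => ?_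
      obtain ⟨c, hc, w, rfl⟩ := gam_loc W z hz
      obtain ⟨y, hy, rfl⟩ := h c hc
      exact ⟨LocalizedModule.mk y w, mk_mem_gam W hy w, by simp⟩
    | succ i =>
      have : Injective (ModuleCat.of R E) := Module.injective_object_of_injective_module R E
      have : Injective (ModuleCat.of (Localization W) (LocalizedModule W E)) :=
        Module.injective_object_of_injective_module _ _
      have h1 := LC.right (seq hf hfg hg) (LC.of_injective (ModuleCat.of R E) i) h
      exact LC.left (seq hf' hfg' hg') (ih _ h1)
        (LC.of_injective (ModuleCat.of (Localization W) (LocalizedModule W E)) _)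

end lcloc
end RelCM

/-- localizations of relative Cohen-Macaulay modules at primes in the
support of `M/aM` are relative Cohen-Macaulay with the same cohomological dimension. -/
theorem stmt1 [IsNoetherianRing R] (a : Ideal R)
    (M : Type u) [AddCommGroup M] [Module R M] [Module.Finite R M]
    (hCM : IsRelCM R a M) (hne : a • (⊤ : Submodule R M) ≠ ⊤)
    (p : PrimeSpectrum R)
    (hp : p ∈ Module.support R (M ⧸ (a • ⊤ : Submodule R M))) :
    IsRelCM (Localization.AtPrime p.asIdeal)
        (a.map (algebraMap R (Localization.AtPrime p.asIdeal)))
        (LocalizedModule p.asIdeal.primeCompl M) ∧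
      rcd (Localization.AtPrime p.asIdeal)
        (a.map (algebraMap R (Localization.AtPrime p.asIdeal)))
        (LocalizedModule p.asIdeal.primeCompl M) = rcd R a M := by
  classical
  have hgc : rgrade R a M = rcd R a M := by
    rcases hCM with h | h
    · exact absurd h hne
    · exact h.2
  generalize hc : rcd R a M = c at hgc ⊢
  -- vanishing over `R`
  have hE : ∀ i < c, Subsingleton (Abelian.Ext (ModuleCat.of R (R ⧸ a)) (ModuleCat.of R M) i) := by
    intro i hi
    rw [← hgc] at hi
    have h1 := Nat.notMem_of_lt_sInf hi
    rw [Set.mem_setOf_eq, RelCM.nontrivial_relExt_iff] at h1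
    exact not_nontrivial_iff_subsingleton.1 h1
  have hL : ∀ i > c, RelCM.LC a i (ModuleCat.of R M) := by
    intro i hi
    obtain ⟨k, hk⟩ := RelCM.LC.bounded a M
    by_contra hcon
    rw [← RelCM.nontrivial_localCoh_iff] at hcon
    have hb : BddAbove {i | Nontrivial (localCoh R a i M)} := by
      refine ⟨k, fun j hj => ?_⟩
      by_contra hjk
      exact (RelCM.nontrivial_localCoh_iff a j M).1 hj (hk j (not_le.1 hjk))
    have h2 : i ≤ rcd R a M := le_csSup hb hcon
    omega
  -- the local situation
  have hap : a ≤ p.asIdeal := by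
    have h1 := hp
    rw [Module.support_eq_zeroLocus, PrimeSpectrum.mem_zeroLocus] at h1
    refine le_trans ?_ h1
    intro r hr
    rw [Module.mem_annihilator]
    intro z
    obtain ⟨m, rfl⟩ := Submodule.Quotient.mk_surjective _ z
    rw [← Submodule.Quotient.mk_smul, Submodule.Quotient.mk_eq_zero]
    exact Submodule.smul_mem_smul hr trivial
  have hpM : p ∈ Module.support R M :=
    Module.support_subset_of_surjective _ (Submodule.mkQ_surjective _) hp
  have hnt : Nontrivial (LocalizedModule p.asIdeal.primeCompl M) := Module.mem_support_iff.1 hpM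
  have hjac : a.map (algebraMap R (Localization.AtPrime p.asIdeal)) ≤ Ideal.jacobson ⊥ := by
    refine le_trans ?_ (IsLocalRing.maximalIdeal_le_jacobson _)
    rw [← Localization.AtPrime.map_eq_maximalIdeal]
    exact Ideal.map_mono hap
  have hnoeth : IsNoetherianRing (Localization.AtPrime p.asIdeal) :=
    IsLocalization.isNoetherianRing p.asIdeal.primeCompl _ inferInstance
  have hfin : Module.Finite (Localization.AtPrime p.asIdeal)
      (LocalizedModule p.asIdeal.primeCompl M) :=
    Module.Finite.of_isLocalizedModule p.asIdeal.primeCompl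
      (LocalizedModule.mkLinearMap p.asIdeal.primeCompl M)
  have hW := RelCM.WReg.loc p.asIdeal.primeCompl (Localization.AtPrime p.asIdeal) c M
    (LocalizedModule p.asIdeal.primeCompl M)
    (LocalizedModule.mkLinearMap p.asIdeal.primeCompl M) (RelCM.wreg_of c M hE)
  have hL' := fun i hi => RelCM.LC.loc p.asIdeal.primeCompl i M (hL i hi)
  generalize a.map (algebraMap R (Localization.AtPrime p.asIdeal)) = b at *
  have hbt : b • (⊤ : Submodule (Localization.AtPrime p.asIdeal)
      (LocalizedModule p.asIdeal.primeCompl M)) ≠ ⊤ := by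
    intro h
    exact top_ne_bot (Submodule.eq_bot_of_le_smul_of_le_jacobson_bot b ⊤ hfin.1 h.ge hjac)
  have hV := RelCM.WReg.vanish c _ hW
  have hne' : ∀ i, i ≠ c → RelCM.LC b i (ModuleCat.of (Localization.AtPrime p.asIdeal)
      (LocalizedModule p.asIdeal.primeCompl M)) := by
    intro i hi
    rcases lt_or_gt_of_ne hi with h | h
    · exact (hV i h).2
    · exact hL' i h
  have hcc : ¬ RelCM.LC b c (ModuleCat.of (Localization.AtPrime p.asIdeal)
      (LocalizedModule p.asIdeal.primeCompl M)) := by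
    intro h
    refine hbt (RelCM.smul_top_of_LC _ fun i => ?_)
    by_cases hi : i = c
    · rw [hi]; exact h
    · exact hne' i hi
  have hcd : rcd (Localization.AtPrime p.asIdeal) b
      (LocalizedModule p.asIdeal.primeCompl M) = c := by
    have : {i | Nontrivial (localCoh (Localization.AtPrime p.asIdeal) b i
        (LocalizedModule p.asIdeal.primeCompl M))} = {c} := by
      ext i
      rw [Set.mem_setOf_eq, RelCM.nontrivial_localCoh_iff, Set.mem_singleton_iff]
      constructor
      · intro h
        by_contra hi
        exact h (hne' i hi)
      · rintro rfl
        exact hcc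
    rw [rcd, this, csSup_singleton]
  have hgr : rgrade (Localization.AtPrime p.asIdeal) b
      (LocalizedModule p.asIdeal.primeCompl M) = c := by
    have hmem : c ∈ {i | Nontrivial (relExt (Localization.AtPrime p.asIdeal) b i
        (LocalizedModule p.asIdeal.primeCompl M))} := by
      rw [Set.mem_setOf_eq, RelCM.nontrivial_relExt_iff]
      by_contra h
      rw [not_nontrivial_iff_subsingleton] at h
      have h1 := RelCM.wreg_of (a := b) (c + 1) (LocalizedModule p.asIdeal.primeCompl M) (by
        intro i hi
        rcases (Nat.lt_succ_iff_lt_or_eq.1 hi) with hi | rfl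
        · exact (hV i hi).1
        · exact h)
      exact hcc (RelCM.WReg.vanish (c + 1) _ h1 c (Nat.lt_succ_self c)).2
    refine le_antisymm (Nat.sInf_le hmem) (le_csInf ⟨c, hmem⟩ fun i hi => ?_)
    by_contra hlt
    rw [Set.mem_setOf_eq, RelCM.nontrivial_relExt_iff] at hi
    exact not_nontrivial_iff_subsingleton.2 (hV i (not_le.1 hlt)).1 hi
  exact ⟨Or.inr ⟨hbt, hgr.trans hcd.symm⟩, hcd⟩
end
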